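/- Let n ≥ 3, m = 2n − 1, let R = ℂ[x, y]^G be the invariant ring of G = 1/m(1,2), set a = x^m, b₁ = x^{m−2}y ∈ R, and let I = (a, b₁) ⊆ R. Define Λ_n to be the quotient of the free ℂ-algebra on generators e₁, e₂, a, b, s₁, …, s_n by the two-sided ideal generated by the relations: e₁² = e₁, e₂² = e₂, e₁e₂ = e₂e₁ = 0, e₁ + e₂ = 1; e₁ a e₂ = a, e₁ b e₂ = b, and e₂ s_i e₁ = s_i for 1 ≤ i ≤ n (so a, b are arrows from vertex 1 to vertex 2 and each s_i an arrow from vertex 2 to vertex 1, with products of paths written left to right, i.e. fg means first f then g); together with s_{n−1} b s_n = s_n b s_{n−1}, a s_n = (b s_{n−1})², s_n a = (s_{n−1} b)², and a s_{i+1} = b s_i, s_{i+1} a = s_i b for all 1 ≤ i ≤ n − 2. Then Λ_n is isomorphic as a ℂ-algebra to End_R(R ⊕ I), the endomorphism algebra of the R-module R ⊕ I (with composition of endomorphisms written left to right, matching the path-product convention). -/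

import Mathlib

/-- The trivial path `e₁` (at vertex 1), as a generator of the free algebra. -/
noncomputable def pe1 (n : ℕ) : FreeAlgebra ℂ (Fin (n + 4)) := FreeAlgebra.ι ℂ 0
/-- The trivial path `e₂` (at vertex 2). -/
noncomputable def pe2 (n : ℕ) : FreeAlgebra ℂ (Fin (n + 4)) := FreeAlgebra.ι ℂ 1
/-- The arrow `a : 1 → 2`. -/
noncomputable def pa (n : ℕ) : FreeAlgebra ℂ (Fin (n + 4)) := FreeAlgebra.ι ℂ 2
/-- The arrow `b : 1 → 2`. -/
noncomputable def pb (n : ℕ) : FreeAlgebra ℂ (Fin (n + 4)) := FreeAlgebra.ι ℂ 3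
/-- The arrow `s_{i+1} : 2 → 1` (for `i : Fin n`, this is `s_{i+1}` in 1-indexed
notation). -/
noncomputable def ps (n : ℕ) (i : Fin n) : FreeAlgebra ℂ (Fin (n + 4)) :=
  FreeAlgebra.ι ℂ ⟨4 + (i : ℕ), by omega⟩

/-- The defining relations of the algebra `Λ_n`: the path-algebra (quiver) relations for
the quiver with vertices `1, 2`, arrows `a, b : 1 → 2` and `s₁, …, s_n : 2 → 1`, together
with the relations `s_{n−1} b s_n = s_n b s_{n−1}`, `a s_n = (b s_{n−1})²`,
`s_n a = (s_{n−1} b)²` and `a s_{i+1} = b s_i`, `s_{i+1} a = s_i b` for `1 ≤ i ≤ n − 2`.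
Products of paths are written left to right. -/
inductive LambdaRel (n : ℕ) :
    FreeAlgebra ℂ (Fin (n + 4)) → FreeAlgebra ℂ (Fin (n + 4)) → Prop
  | e1_idem : LambdaRel n (pe1 n * pe1 n) (pe1 n)
  | e2_idem : LambdaRel n (pe2 n * pe2 n) (pe2 n)
  | orth12 : LambdaRel n (pe1 n * pe2 n) 0
  | orth21 : LambdaRel n (pe2 n * pe1 n) 0
  | sum_idem : LambdaRel n (pe1 n + pe2 n) 1
  | path_a : LambdaRel n (pe1 n * pa n * pe2 n) (pa n)
  | path_b : LambdaRel n (pe1 n * pb n * pe2 n) (pb n)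
  | path_s (i : Fin n) : LambdaRel n (pe2 n * ps n i * pe1 n) (ps n i)
  | rel_sbs (h : 3 ≤ n) :
      LambdaRel n (ps n ⟨n - 2, by omega⟩ * pb n * ps n ⟨n - 1, by omega⟩)
        (ps n ⟨n - 1, by omega⟩ * pb n * ps n ⟨n - 2, by omega⟩)
  | rel_asn (h : 3 ≤ n) :
      LambdaRel n (pa n * ps n ⟨n - 1, by omega⟩)
        ((pb n * ps n ⟨n - 2, by omega⟩) ^ 2)
  | rel_sna (h : 3 ≤ n) :
      LambdaRel n (ps n ⟨n - 1, by omega⟩ * pa n)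
        ((ps n ⟨n - 2, by omega⟩ * pb n) ^ 2)
  | rel_as (i : ℕ) (h1 : 1 ≤ i) (h2 : i ≤ n - 2) :
      LambdaRel n (pa n * ps n ⟨i, by omega⟩) (pb n * ps n ⟨i - 1, by omega⟩)
  | rel_sa (i : ℕ) (h1 : 1 ≤ i) (h2 : i ≤ n - 2) :
      LambdaRel n (ps n ⟨i, by omega⟩ * pa n) (ps n ⟨i - 1, by omega⟩ * pb n)

/-- The algebra `Λ_n`: the quotient of the free algebra on `e₁, e₂, a, b, s₁, …, s_n`
by the two-sided ideal generated by the relations `LambdaRel n`. -/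
noncomputable def Lambda (n : ℕ) : Type := RingQuot (LambdaRel n)

noncomputable instance (n : ℕ) : Ring (Lambda n) :=
  inferInstanceAs (Ring (RingQuot (LambdaRel n)))

noncomputable instance (n : ℕ) : Algebra ℂ (Lambda n) :=
  inferInstanceAs (Algebra ℂ (RingQuot (LambdaRel n)))

open MvPolynomial

/-- For a tower `K → R → M` with `R` commutative, the `R`- and `K`-actions commute. -/
instance (priority := 60) towerSMulCommClass (K R M : Type) [CommSemiring K] [CommRing R]
    [Algebra K R] [AddCommGroup M] [Module R M] [Module K M] [IsScalarTower K R M] :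
    SMulCommClass R K M :=
  ⟨fun r k x => by
    rw [← algebraMap_smul R k x, ← mul_smul, mul_comm, mul_smul, algebraMap_smul]⟩


structure QRel {A : Type} [Ring A] (p : ℕ) (e1 e2 a b : A) (s : ℕ → A) : Prop where
  e11 : e1 * e1 = e1
  e22 : e2 * e2 = e2
  e12 : e1 * e2 = 0
  e21 : e2 * e1 = 0
  sum : e1 + e2 = 1
  pa : e1 * a * e2 = a
  pb : e1 * b * e2 = b
  ps : ∀ i ≤ p + 1, e2 * s i * e1 = s i
  sbs : s p * b * s (p + 1) = s (p + 1) * b * s p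
  asn : a * s (p + 1) = (b * s p) ^ 2
  sna : s (p + 1) * a = (s p * b) ^ 2
  as' : ∀ i < p, a * s (i + 1) = b * s i
  sa' : ∀ i < p, s (i + 1) * a = s i * b

/-- central elements -/
def zc {A : Type} [Ring A] (a b : A) (s : ℕ → A) : ℕ → A
  | 0 => a * s 0 + s 0 * a
  | i + 1 => b * s i + s i * b

inductive PZ {A : Type} [Ring A] (p : ℕ) (z : ℕ → A) : ℕ → ℕ → A → Prop
  | one : PZ p z 0 0 1
  | mul (k I J I' J' : ℕ) (w w' : A) (hk : k ≤ p + 1) (h : PZ p z I J w)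
      (hI : I' + 2 * k = I + 2 * p + 3) (hJ : J' = J + k) (hw : w' = z k * w) : PZ p z I' J' w'
  | top (I J J' : ℕ) (w w' : A) (h : PZ p z I J w)
      (hJ : J' = J + (2 * p + 3)) (hw : w' = z (p + 2) * w) : PZ p z I J' w'

namespace QRel
variable {A : Type} [Ring A] {p : ℕ} {e1 e2 a b : A} {s : ℕ → A}

theorem e1a (h : QRel p e1 e2 a b s) : e1 * a = a := by
  rw [← h.pa]; simp only [← mul_assoc, h.e11]
theorem e1b (h : QRel p e1 e2 a b s) : e1 * b = b := by
  rw [← h.pb]; simp only [← mul_assoc, h.e11]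
theorem ae2 (h : QRel p e1 e2 a b s) : a * e2 = a := by
  rw [← h.pa]; simp only [mul_assoc, h.e22]
theorem be2 (h : QRel p e1 e2 a b s) : b * e2 = b := by
  rw [← h.pb]; simp only [mul_assoc, h.e22]
theorem e2a (h : QRel p e1 e2 a b s) : e2 * a = 0 := by
  rw [← h.pa]; simp only [← mul_assoc, h.e21, zero_mul]
theorem e2b (h : QRel p e1 e2 a b s) : e2 * b = 0 := by
  rw [← h.pb]; simp only [← mul_assoc, h.e21, zero_mul]
theorem ae1 (h : QRel p e1 e2 a b s) : a * e1 = 0 := by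
  rw [← h.pa]; simp only [mul_assoc, h.e21, mul_zero]
theorem be1 (h : QRel p e1 e2 a b s) : b * e1 = 0 := by
  rw [← h.pb]; simp only [mul_assoc, h.e21, mul_zero]
theorem e2s (h : QRel p e1 e2 a b s) {i : ℕ} (hi : i ≤ p + 1) : e2 * s i = s i := by
  rw [← h.ps i hi]; simp only [← mul_assoc, h.e22]
theorem se1 (h : QRel p e1 e2 a b s) {i : ℕ} (hi : i ≤ p + 1) : s i * e1 = s i := by
  rw [← h.ps i hi]; simp only [mul_assoc, h.e11]
theorem e1s (h : QRel p e1 e2 a b s) {i : ℕ} (hi : i ≤ p + 1) : e1 * s i = 0 := by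
  rw [← h.ps i hi]; simp only [← mul_assoc, h.e12, zero_mul]
theorem se2 (h : QRel p e1 e2 a b s) {i : ℕ} (hi : i ≤ p + 1) : s i * e2 = 0 := by
  rw [← h.ps i hi]; simp only [mul_assoc, h.e12, mul_zero]
theorem aa (h : QRel p e1 e2 a b s) : a * a = 0 := by
  nth_rw 1 [← h.ae2]; rw [mul_assoc, h.e2a, mul_zero]
theorem ab (h : QRel p e1 e2 a b s) : a * b = 0 := by
  nth_rw 1 [← h.ae2]; rw [mul_assoc, h.e2b, mul_zero]
theorem ba (h : QRel p e1 e2 a b s) : b * a = 0 := by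
  nth_rw 1 [← h.be2]; rw [mul_assoc, h.e2a, mul_zero]
theorem bb (h : QRel p e1 e2 a b s) : b * b = 0 := by
  nth_rw 1 [← h.be2]; rw [mul_assoc, h.e2b, mul_zero]
theorem ss (h : QRel p e1 e2 a b s) {i j : ℕ} (hi : i ≤ p + 1) (hj : j ≤ p + 1) :
    s i * s j = 0 := by
  rw [← h.se1 hi, mul_assoc, h.e1s hj, mul_zero]

/-- `b s_i a = a s_i b`. -/
theorem bsa (h : QRel p e1 e2 a b s) (hp : 1 ≤ p) {i : ℕ} (hi : i ≤ p + 1) :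
    b * s i * a = a * s i * b := by
  rcases Nat.lt_or_ge p i with h1 | h1
  · obtain rfl : i = p + 1 := by omega
    rw [h.asn, mul_assoc, h.sna]; noncomm_ring
  · rcases i with _ | i
    · rw [← h.as' 0 (by omega), mul_assoc, h.sa' 0 (by omega), mul_assoc]
    · rw [h.as' i (by omega), mul_assoc, h.sa' i (by omega), mul_assoc]

theorem sbs1 (h : QRel p e1 e2 a b s) (d : ℕ) : ∀ {i : ℕ}, i + d ≤ p →
    s i * b * s (i + d) = s (i + d) * b * s i := by
  induction d using Nat.strong_induction_on with
  | _ d ih =>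
    intro i hi
    match d with
    | 0 => rfl
    | 1 => rw [← h.sa' i (by omega), mul_assoc, mul_assoc, h.as' i (by omega)]
    | d + 2 =>
      have := ih d (by omega) (i := i + 1) (by omega)
      rw [← h.sa' i (by omega), mul_assoc, show i + (d + 2) = (i + 1 + d) + 1 by omega,
        h.as' (i + 1 + d) (by omega), ← mul_assoc, this, mul_assoc, mul_assoc,
        ← h.as' i (by omega), ← mul_assoc (s (i + 1 + d + 1)), h.sa' (i + 1 + d) (by omega),
        mul_assoc]

theorem sbs2 (h : QRel p e1 e2 a b s) {i j : ℕ} (hi : i ≤ p) (hj : j ≤ p) :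
    s i * b * s j = s j * b * s i := by
  rcases Nat.le_total i j with h1 | h1
  · obtain ⟨d, rfl⟩ := Nat.exists_eq_add_of_le h1
    exact h.sbs1 d hj
  · obtain ⟨d, rfl⟩ := Nat.exists_eq_add_of_le h1
    exact (h.sbs1 d hi).symm

theorem sas_top (h : QRel p e1 e2 a b s) {i : ℕ} (hi : i ≤ p) :
    s i * a * s (p + 1) = s (p + 1) * a * s i := by
  have e := h.sbs2 hi le_rfl
  calc s i * a * s (p + 1) = (s i * b * s p) * b * s p := by
        rw [mul_assoc, h.asn]; noncomm_ring
    _ = s p * b * (s i * b * s p) := by nth_rw 1 [e]; noncomm_ring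
    _ = s (p + 1) * a * s i := by rw [e, h.sna]; noncomm_ring

theorem sbs_top (h : QRel p e1 e2 a b s) {i : ℕ} (hi : i ≤ p) :
    s i * b * s (p + 1) = s (p + 1) * b * s i := by
  rcases Nat.lt_or_ge i p with h1 | h1
  · rw [← h.sa' i h1, h.sas_top (by omega), mul_assoc, h.as' i h1, mul_assoc]
  · obtain rfl : i = p := by omega
    exact h.sbs

theorem sbs3 (h : QRel p e1 e2 a b s) {i j : ℕ} (hi : i ≤ p + 1) (hj : j ≤ p + 1) :
    s i * b * s j = s j * b * s i := by
  rcases Nat.lt_or_ge p i with h1 | h1 <;> rcases Nat.lt_or_ge p j with h2 | h2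
  · obtain rfl : i = j := by omega
    rfl
  · obtain rfl : i = p + 1 := by omega
    exact (h.sbs_top h2).symm
  · obtain rfl : j = p + 1 := by omega
    exact (h.sbs_top h1)
  · exact h.sbs2 h1 h2

theorem sas0 (h : QRel p e1 e2 a b s) {j : ℕ} (hj : j ≤ p + 1) :
    s 0 * a * s j = s j * a * s 0 := by
  rcases Nat.lt_or_ge p j with h2 | h2
  · obtain rfl : j = p + 1 := by omega
    exact h.sas_top (by omega)
  · rcases j with _ | j
    · rfl
    · rw [mul_assoc, h.as' j (by omega), ← mul_assoc, h.sa' j (by omega),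
        h.sbs2 (by omega) (by omega)]

theorem za (h : QRel p e1 e2 a b s) (hp : 1 ≤ p) {k : ℕ} (hk : k ≤ p + 2) :
    Commute (zc a b s k) a := by
  rcases k with _ | k
  · simp only [zc, Commute, SemiconjBy, add_mul, mul_add]
    rw [mul_assoc (s 0), h.aa, ← mul_assoc, h.aa, ← mul_assoc]; simp
  · simp only [zc, Commute, SemiconjBy, add_mul, mul_add]
    rw [mul_assoc (s k), h.ba, ← mul_assoc a b, h.ab, ← mul_assoc, h.bsa hp (by omega)]; simp

theorem zb (h : QRel p e1 e2 a b s) (hp : 1 ≤ p) {k : ℕ} (hk : k ≤ p + 2) :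
    Commute (zc a b s k) b := by
  rcases k with _ | k
  · simp only [zc, Commute, SemiconjBy, add_mul, mul_add]
    rw [mul_assoc (s 0), h.ab, ← mul_assoc, h.ba, ← mul_assoc, h.bsa hp (by omega)]; simp
  · simp only [zc, Commute, SemiconjBy, add_mul, mul_add]
    rw [mul_assoc (s k), h.bb, ← mul_assoc b b, h.bb, ← mul_assoc]; simp

theorem zs (h : QRel p e1 e2 a b s) {k : ℕ} (hk : k ≤ p + 2) {j : ℕ} (hj : j ≤ p + 1) :
    Commute (zc a b s k) (s j) := by
  rcases k with _ | k
  · simp only [zc, Commute, SemiconjBy, add_mul, mul_add]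
    rw [mul_assoc a, h.ss (by omega) hj, h.sas0 hj, ← mul_assoc (s j) (s 0),
      h.ss hj (by omega), ← mul_assoc]; simp
  · simp only [zc, Commute, SemiconjBy, add_mul, mul_add]
    rw [mul_assoc b, h.ss (by omega) hj, h.sbs3 (by omega) hj, ← mul_assoc (s j) (s k),
      h.ss hj (by omega), ← mul_assoc]; simp

theorem ze1 (h : QRel p e1 e2 a b s) {k : ℕ} (hk : k ≤ p + 2) :
    Commute (zc a b s k) e1 := by
  rcases k with _ | k
  · simp only [zc, Commute, SemiconjBy, add_mul, mul_add]
    rw [mul_assoc a, h.se1 (by omega), mul_assoc, h.ae1, ← mul_assoc, ← mul_assoc, h.e1a,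
      h.e1s (by omega)]; simp
  · simp only [zc, Commute, SemiconjBy, add_mul, mul_add]
    rw [mul_assoc b, h.se1 (by omega), mul_assoc, h.be1, ← mul_assoc, ← mul_assoc, h.e1b,
      h.e1s (by omega)]; simp

theorem ze2 (h : QRel p e1 e2 a b s) {k : ℕ} (hk : k ≤ p + 2) :
    Commute (zc a b s k) e2 := by
  have : e2 = 1 - e1 := by rw [← h.sum]; abel
  rw [this]
  exact (Commute.one_right _).sub_right (h.ze1 hk)

theorem zz (h : QRel p e1 e2 a b s) (hp : 1 ≤ p) {k l : ℕ} (hk : k ≤ p + 2) (hl : l ≤ p + 2) :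
    Commute (zc a b s k) (zc a b s l) := by
  rcases l with _ | l
  · exact ((h.za hp hk).mul_right (h.zs hk (by omega))).add_right
      ((h.zs hk (by omega)).mul_right (h.za hp hk))
  · exact ((h.zb hp hk).mul_right (h.zs hk (by omega))).add_right
      ((h.zs hk (by omega)).mul_right (h.zb hp hk))

/- products of arrows -/
theorem sb_eq (h : QRel p e1 e2 a b s) {i : ℕ} (hi : i ≤ p + 1) :
    s i * b = zc a b s (i + 1) * e2 := by
  simp only [zc, add_mul]
  rw [mul_assoc b, h.se2 hi, mul_assoc, h.be2]; simp
theorem bs_eq (h : QRel p e1 e2 a b s) {i : ℕ} (hi : i ≤ p + 1) :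
    b * s i = zc a b s (i + 1) * e1 := by
  simp only [zc, add_mul]
  rw [mul_assoc b, h.se1 hi, mul_assoc, h.be1]; simp
theorem sa_eq (h : QRel p e1 e2 a b s) {i : ℕ} (hi : i ≤ p) :
    s i * a = zc a b s i * e2 := by
  rcases i with _ | i
  · simp only [zc, add_mul]
    rw [mul_assoc a, h.se2 (by omega), mul_assoc, h.ae2]; simp
  · rw [h.sa' i (by omega), h.sb_eq (by omega)]
theorem as_eq (h : QRel p e1 e2 a b s) {i : ℕ} (hi : i ≤ p) :
    a * s i = zc a b s i * e1 := by
  rcases i with _ | i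
  · simp only [zc, add_mul]
    rw [mul_assoc a, h.se1 (by omega), mul_assoc, h.ae1]; simp
  · rw [h.as' i (by omega), h.bs_eq (by omega)]
theorem sa_top (h : QRel p e1 e2 a b s) :
    s (p + 1) * a = zc a b s (p + 1) * zc a b s (p + 1) * e2 := by
  rw [h.sna, h.sb_eq (by omega), sq, mul_assoc, ← mul_assoc e2, ← (h.ze2 (by omega)).eq,
    mul_assoc, h.e22, mul_assoc]
theorem as_top (h : QRel p e1 e2 a b s) :
    a * s (p + 1) = zc a b s (p + 1) * zc a b s (p + 1) * e1 := by
  rw [h.asn, h.bs_eq (by omega), sq, mul_assoc, ← mul_assoc e1, ← (h.ze1 (by omega)).eq,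
    mul_assoc, h.e11, mul_assoc]

end QRel

/-- step hypothesis: `t'` is `t` times `y / x^2`. -/
structure ZStep {A : Type} [Ring A] (p : ℕ) (z : ℕ → A) (t t' : A) : Prop where
  st : ∀ k ≤ p, z (k + 1) * t = z k * t'
  tp : z (p + 2) * t = z (p + 1) * z (p + 1) * t'

namespace QRel
variable {A : Type} [Ring A] {p : ℕ} {e1 e2 a b : A} {s : ℕ → A}

theorem step_ab (h : QRel p e1 e2 a b s) (hp : 1 ≤ p) : ZStep p (zc a b s) a b where
  st k hk := by
    rw [show zc a b s (k + 1) * a = zc a b s (k + 1) * e1 * a by rw [mul_assoc, h.e1a],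
      ← h.bs_eq (by omega), mul_assoc, h.sa_eq hk, ← mul_assoc, ← (h.zb hp (by omega)).eq, mul_assoc, h.be2]
  tp := by
    rw [show zc a b s (p + 2) * a = zc a b s (p + 2) * e1 * a by rw [mul_assoc, h.e1a],
      ← h.bs_eq (by omega), mul_assoc, h.sa_top, ← mul_assoc,
      ← ((h.zb hp (by omega)).mul_left (h.zb hp (by omega))).eq, mul_assoc, h.be2]

theorem step_s (h : QRel p e1 e2 a b s) {i : ℕ} (hi : i < p) :
    ZStep p (zc a b s) (s i) (s (i + 1)) where
  st k hk := by
    rw [show zc a b s (k + 1) * s i = zc a b s (k + 1) * e2 * s i by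
        rw [mul_assoc, h.e2s (by omega)],
      ← h.sb_eq (by omega), mul_assoc, ← h.as' i hi, ← mul_assoc, h.sa_eq hk, mul_assoc,
      h.e2s (by omega)]
  tp := by
    rw [show zc a b s (p + 2) * s i = zc a b s (p + 2) * e2 * s i by
        rw [mul_assoc, h.e2s (by omega)],
      ← h.sb_eq (by omega), mul_assoc, ← h.as' i hi, ← mul_assoc, h.sa_top, mul_assoc,
      h.e2s (by omega)]

theorem ext_e (h : QRel p e1 e2 a b s) {u v : A} (h1 : u * e1 = v * e1) (h2 : u * e2 = v * e2) :
    u = v := by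
  rw [← mul_one u, ← mul_one v, ← h.sum, mul_add, mul_add, h1, h2]

theorem step_z (h : QRel p e1 e2 a b s) (hp : 1 ≤ p) {i : ℕ} (hi : i ≤ p) :
    ZStep p (zc a b s) (zc a b s i) (zc a b s (i + 1)) := by
  have hab := h.step_ab hp
  have key : ∀ u v : A, Commute u (s i) → Commute v (s i) → u * a = v * b →
      u * zc a b s i = v * zc a b s (i + 1) := by
    intro u v hu hv huv
    apply h.ext_e
    · rw [mul_assoc, mul_assoc, ← h.as_eq hi, ← h.bs_eq (by omega), ← mul_assoc, huv, mul_assoc]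
    · rw [mul_assoc, mul_assoc, ← h.sa_eq hi, ← h.sb_eq (by omega), ← mul_assoc, hu.eq,
        ← mul_assoc, hv.eq, mul_assoc, huv, mul_assoc]
  constructor
  · intro k hk
    exact key _ _ (h.zs (by omega) (by omega)) (h.zs (by omega) (by omega)) (hab.st k hk)
  · exact key _ _ (h.zs (by omega) (by omega))
      ((h.zs (by omega) (by omega)).mul_left (h.zs (by omega) (by omega))) hab.tp

theorem top_s (h : QRel p e1 e2 a b s) {k : ℕ} (hk : k ≤ p) :
    zc a b s k * s (p + 1) = zc a b s (p + 1) * zc a b s (p + 1) * s k := by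
  rw [show zc a b s k * s (p + 1) = zc a b s k * e2 * s (p + 1) by
        rw [mul_assoc, h.e2s (by omega)], ← h.sa_eq hk, mul_assoc, h.as_top, ← mul_assoc,
    ← ((h.zs (j := k) (by omega) (by omega)).mul_left (h.zs (by omega) (by omega))).eq, mul_assoc,
    h.se1 (by omega)]

theorem top_s' (h : QRel p e1 e2 a b s) :
    zc a b s (p + 1) * s (p + 1) = zc a b s (p + 2) * s p := by
  rw [show zc a b s (p + 1) * s (p + 1) = zc a b s (p + 1) * e2 * s (p + 1) by
        rw [mul_assoc, h.e2s (by omega)], ← h.sb_eq (by omega), h.sbs, h.sb_eq (by omega),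
      mul_assoc, h.e2s (by omega)]
end QRel


namespace PZ
variable {A : Type} [Ring A] {p : ℕ} {z : ℕ → A}

theorem comm {x : A} (hc : ∀ k ≤ p + 2, Commute x (z k)) {I J : ℕ} {w : A}
    (h : PZ p z I J w) : Commute x w := by
  induction h with
  | one => exact Commute.one_right _
  | mul k I J I' J' w w' hk h hI hJ hw ih => rw [hw]; exact (hc k (by omega)).mul_right ih
  | top I J J' w w' h hJ hw ih => rw [hw]; exact (hc _ (by omega)).mul_right ih

theorem raise (hc : ∀ k ≤ p + 2, ∀ l ≤ p + 2, Commute (z k) (z l)) {t t' : A}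
    (ht : ZStep p z t t') {I J : ℕ} {w : A} (h : PZ p z I J w) (hJ : 1 ≤ J) :
    ∃ w', PZ p z (I + 2) (J - 1) w' ∧ w * t = w' * t' := by
  induction h with
  | one => omega
  | mul k I J I' J' w w' hk h hI hJ' hw ih =>
    rcases k with _ | k
    · obtain ⟨v, hv, e⟩ := ih (by omega)
      refine ⟨z 0 * v, .mul 0 _ _ _ _ _ _ (by omega) hv (by omega) (by omega) rfl, ?_⟩
      rw [hw, mul_assoc, e, mul_assoc]
    · refine ⟨z k * w, .mul k _ _ _ _ _ _ (by omega) h (by omega) (by omega) rfl, ?_⟩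
      rw [hw, (h.comm (hc (k + 1) (by omega))).eq, mul_assoc, ht.st k (by omega), ← mul_assoc,
        (h.comm (hc k (by omega))).eq]
  | top I J J' w w' h hJ' hw ih =>
    refine ⟨z (p + 1) * (z (p + 1) * w), .mul (p + 1) (I + 1) (J + (p + 1)) _ _ _ _ (by omega)
      (.mul (p + 1) _ _ _ _ _ _ (by omega) h (by omega) rfl rfl) (by omega) (by omega) rfl, ?_⟩
    have c := h.comm (hc (p + 1) (by omega))
    rw [hw, (h.comm (hc (p + 2) (by omega))).eq, mul_assoc, ht.tp, ← mul_assoc, ← mul_assoc (z _),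
      ((c.mul_left c)).eq]

theorem raise_many (hc : ∀ k ≤ p + 2, ∀ l ≤ p + 2, Commute (z k) (z l)) {t : ℕ → A} {L : ℕ}
    (ht : ∀ i < L, ZStep p z (t i) (t (i + 1))) (d : ℕ) : ∀ {i I J : ℕ} {w : A},
    PZ p z I J w → d ≤ J → i + d ≤ L →
    ∃ w', PZ p z (I + 2 * d) (J - d) w' ∧ w * t i = w' * t (i + d) := by
  induction d with
  | zero => intro i I J w h _ _; exact ⟨w, h, rfl⟩
  | succ d ih =>
    intro i I J w h h1 h2
    obtain ⟨v, hv, e⟩ := h.raise hc (ht i (by omega)) (by omega)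
    obtain ⟨u, hu, e'⟩ := ih (i := i + 1) hv (by omega) (by omega)
    refine ⟨u, ?_, ?_⟩
    · convert hu using 1 <;> omega
    · rw [e, e']; congr 2; omega

theorem fam (hc : ∀ k ≤ p + 2, ∀ l ≤ p + 2, Commute (z k) (z l)) {t : ℕ → A} {L : ℕ}
    (ht : ∀ i < L, ZStep p z (t i) (t (i + 1))) {i j I J I' J' : ℕ} {w w' : A}
    (hi : i ≤ L) (hj : j ≤ L) (h : PZ p z I J w) (h' : PZ p z I' J' w')
    (hI : I + 2 * j = I' + 2 * i) (hJ : J + i = J' + j)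
    (U : ∀ u v, PZ p z I J u → PZ p z I J v → u = v)
    (U' : ∀ u v, PZ p z I' J' u → PZ p z I' J' v → u = v) : w * t i = w' * t j := by
  rcases Nat.le_total i j with hij | hij
  · obtain ⟨d, rfl⟩ := Nat.exists_eq_add_of_le hij
    obtain ⟨v, hv, e⟩ := raise_many hc ht d h (by omega) hj
    rw [e, U' v w' (by convert hv using 1 <;> omega) h']
  · obtain ⟨d, rfl⟩ := Nat.exists_eq_add_of_le hij
    obtain ⟨v, hv, e⟩ := raise_many hc ht d h' (by omega) hi
    rw [e, U w v h (by convert hv using 1 <;> omega)]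

theorem lower (hc : ∀ k ≤ p + 2, ∀ l ≤ p + 2, Commute (z k) (z l)) {I J : ℕ} {w : A}
    (h : PZ p z I J w) (hI : 1 ≤ I) : ∃ k I0 J0 w0, k ≤ p + 1 ∧ PZ p z I0 J0 w0 ∧
      I + 2 * k = I0 + 2 * p + 3 ∧ J = J0 + k ∧ w = z k * w0 := by
  induction h with
  | one => omega
  | mul k I J I' J' w w' hk h hI' hJ' hw ih => exact ⟨k, I, J, w, hk, h, hI', hJ', hw⟩
  | top I J J' w w' h hJ' hw ih =>
    obtain ⟨k, I0, J0, w0, hk, h0, h1, h2, e⟩ := ih hI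
    refine ⟨k, I0, J0 + (2 * p + 3), z (p + 2) * w0, hk, .top _ _ _ _ _ h0 rfl rfl, h1,
      by omega, ?_⟩
    rw [hw, e, ← mul_assoc, (hc (p + 2) (by omega) k (by omega)).eq, mul_assoc]

theorem uniq (hc : ∀ k ≤ p + 2, ∀ l ≤ p + 2, Commute (z k) (z l))
    (ht : ∀ i < p + 1, ZStep p z (z i) (z (i + 1))) (N : ℕ) : ∀ {I J : ℕ} {w w' : A}, I + J = N →
    PZ p z I J w → PZ p z I J w' → w = w' := by
  induction N using Nat.strong_induction_on with
  | _ N ih =>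
    intro I J w w' hN h h'
    rcases Nat.eq_zero_or_pos I with h0 | h0
    · cases h with
      | one =>
        cases h' with
        | one => rfl
        | mul k I J I' J' v v' hk h hI hJ' hw => omega
        | top I J J' v v' h hJ' hw => omega
      | mul k I J I' J' v v' hk h hI hJ' hw => omega
      | top I J J' v v' h hJ hw =>
        cases h' with
        | one => omega
        | mul k I J I' J' u u' hk h hI hJ' hw => omega
        | top I J' J'' u u' h' hJ' hw' =>
          obtain rfl : J = J' := by omega
          rw [hw, hw', ih _ (by omega) rfl h h']
    · obtain ⟨k, I1, J1, w1, hk, h1, h2, h3, e⟩ := h.lower hc h0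
      obtain ⟨k', I1', J1', w1', hk', h1', h2', h3', e'⟩ := h'.lower hc h0
      rw [e, e', (h1.comm (hc k (by omega))).eq, (h1'.comm (hc k' (by omega))).eq]
      exact fam hc ht hk hk' h1 h1' (by omega) (by omega)
        (fun u v hu hv => ih _ (by omega) rfl hu hv) (fun u v hu hv => ih _ (by omega) rfl hu hv)
end PZ

inductive NF {A : Type} [Ring A] (p : ℕ) (e1 e2 a b : A) (s : ℕ → A) :
    Fin 2 → Fin 2 → ℕ → ℕ → A → Prop
  | e1 (I J : ℕ) (w : A) (h : PZ p (zc a b s) I J w) : NF p e1 e2 a b s 0 0 I J (w * e1)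
  | e2 (I J : ℕ) (w : A) (h : PZ p (zc a b s) I J w) : NF p e1 e2 a b s 1 1 I J (w * e2)
  | a (I J I' : ℕ) (w : A) (h : PZ p (zc a b s) I J w) (hI : I' = I + 2) :
    NF p e1 e2 a b s 0 1 I' J (w * a)
  | b (I J J' : ℕ) (w : A) (h : PZ p (zc a b s) I J w) (hJ : J' = J + 1) :
    NF p e1 e2 a b s 0 1 I J' (w * b)
  | s (i I J I' J' : ℕ) (w : A) (hi : i ≤ p) (h : PZ p (zc a b s) I J w)
    (hI : I' + 2 * i = I + 2 * p + 1) (hJ : J' = J + i) :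
    NF p e1 e2 a b s 1 0 I' J' (w * s i)
  | st (I J J' : ℕ) (w : A) (h : PZ p (zc a b s) I J w)
    (hJ : J' = J + (2 * p + 2)) :
    NF p e1 e2 a b s 1 0 I J' (w * s (p + 1))

namespace QRel
variable {A : Type} [Ring A] {p : ℕ} {e1 e2 a b : A} {s : ℕ → A}

theorem uq (h : QRel p e1 e2 a b s) (hp : 1 ≤ p) {I J : ℕ} {w w' : A}
    (h1 : PZ p (zc a b s) I J w) (h2 : PZ p (zc a b s) I J w') : w = w' :=
  PZ.uniq (fun _ hk _ hl => h.zz hp hk hl) (fun _ hi => h.step_z hp (by omega)) _ rfl h1 h2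

theorem uq_ab (h : QRel p e1 e2 a b s) (hp : 1 ≤ p) {I J I' J' : ℕ} {w w' : A}
    (h1 : PZ p (zc a b s) I J w) (h2 : PZ p (zc a b s) I' J' w') (hI : I + 2 = I')
    (hJ : J = J' + 1) : w * a = w' * b := by
  obtain ⟨v, hv, e⟩ := h1.raise (fun _ hk _ hl => h.zz hp hk hl) (h.step_ab hp) (by omega)
  rw [e, h.uq hp h2 (by convert hv using 1 <;> omega)]

theorem uq_s (h : QRel p e1 e2 a b s) (hp : 1 ≤ p) {i j I J I' J' : ℕ} {w w' : A}
    (hi : i ≤ p) (hj : j ≤ p)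
    (h1 : PZ p (zc a b s) I J w) (h2 : PZ p (zc a b s) I' J' w')
    (hI : I + 2 * j = I' + 2 * i) (hJ : J + i = J' + j) : w * s i = w' * s j :=
  PZ.fam (t := s) (fun _ hk _ hl => h.zz hp hk hl) (fun _ hi => h.step_s hi) hi hj h1 h2 hI hJ
    (fun _ _ => h.uq hp) (fun _ _ => h.uq hp)

theorem uq_st (h : QRel p e1 e2 a b s) (hp : 1 ≤ p) {i I J I' J' : ℕ} {w w' : A}
    (hi : i ≤ p) 
    (h1 : PZ p (zc a b s) I J w) (h2 : PZ p (zc a b s) I' J' w')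
    (hI : I + 2 * i = I' + 2 * p + 1) (hJ : J + (2 * p + 2) = J' + i) :
    w * s (p + 1) = w' * s i := by
  obtain ⟨k, I0, J0, w0, hk, h0, hI0, hJ0, e⟩ := h1.lower (fun _ hk _ hl => h.zz hp hk hl)
    (by omega)
  have c : ∀ k ≤ p + 2, Commute (zc a b s k) w0 := fun k hk => h0.comm (fun _ hl => h.zz hp hk hl)
  rcases Nat.lt_or_ge p k with h3 | h3
  · obtain rfl : k = p + 1 := by omega
    rw [e, (c _ (by omega)).eq, mul_assoc, h.top_s', ← mul_assoc, ← (c _ (by omega)).eq]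
    exact h.uq_s hp le_rfl hi (.top _ _ _ _ _ h0 rfl rfl) h2 (by omega) (by omega)
  · rw [e, (c _ (by omega)).eq, mul_assoc, h.top_s h3, ← mul_assoc,
      ← ((c _ (by omega)).mul_left (c _ (by omega))).eq, mul_assoc (zc a b s _)]
    exact h.uq_s hp h3 hi (.mul (p + 1) (I0 + 1) (J0 + (p + 1)) (I0 + 2) _ _ _ le_rfl
      (.mul (p + 1) _ _ _ _ _ _ le_rfl h0 (by omega) rfl rfl) (by omega) rfl rfl) h2
      (by omega) (by omega)

theorem nf_uniq (h : QRel p e1 e2 a b s) (hp : 1 ≤ p) {i j : Fin 2} {I J : ℕ} {w w' : A}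
    (h1 : NF p e1 e2 a b s i j I J w) (h2 : NF p e1 e2 a b s i j I J w') : w = w' := by
  cases h1 with
  | e1 _ _ w h1 => cases h2 with | e1 _ _ w h2 => rw [h.uq hp h1 h2]
  | e2 _ _ w h1 => cases h2 with | e2 _ _ w h2 => rw [h.uq hp h1 h2]
  | a I J I' w h1 hI =>
    cases h2 with
    | a I2 J2 I2' w2 h2 hI2 =>
      obtain rfl : I = I2 := by omega
      rw [h.uq hp h1 h2]
    | b I2 J2 I2' w2 h2 hI2 => exact h.uq_ab hp h1 h2 (by omega) (by omega)
  | b I J I' w h1 hI =>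
    cases h2 with
    | a I2 J2 I2' w2 h2 hI2 => exact (h.uq_ab hp h2 h1 (by omega) (by omega)).symm
    | b I2 J2 I2' w2 h2 hI2 => 
      obtain rfl : J = J2 := by omega
      rw [h.uq hp h1 h2]
  | s i I J I' J' w hi h1 hI hJ =>
    cases h2 with
    | s i2 I2 J2 I2' J2' w2 hi2 h2 hI2 hJ2 => exact h.uq_s hp hi hi2 h1 h2 (by omega) (by omega)
    | st I2 J2 J2' w2 h2 hJ2 => exact (h.uq_st hp hi h2 h1 (by omega) (by omega)).symm
  | st I J J' w h1 hJ =>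
    cases h2 with
    | s i2 I2 J2 I2' J2' w2 hi2 h2 hI2 hJ2 => exact (h.uq_st hp hi2 h1 h2 (by omega) (by omega))
    | st I2 J2 J2' w2 h2 hJ2 =>
      obtain rfl : J = J2 := by omega
      rw [h.uq hp h1 h2]

/-- the set of normal form words -/
def nfset (p : ℕ) (e1 e2 a b : A) (s : ℕ → A) : Set A :=
  {w | ∃ i j I J, NF p e1 e2 a b s i j I J w}

theorem nf_one [Algebra ℂ A] (h : QRel p e1 e2 a b s) :
    (1 : A) ∈ Submodule.span ℂ (nfset p e1 e2 a b s) := by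
  rw [← h.sum]
  refine add_mem (Submodule.subset_span ⟨0, 0, 0, 0, ?_⟩) (Submodule.subset_span ⟨1, 1, 0, 0, ?_⟩)
  · simpa using NF.e1 (e1 := e1) (e2 := e2) 0 0 1 (PZ.one (p := p) (z := zc a b s))
  · simpa using NF.e2 (e1 := e1) (e2 := e2) 0 0 1 (PZ.one (p := p) (z := zc a b s))

theorem span_mul [Algebra ℂ A] {W : Set A} {g : A} (H : ∀ w ∈ W, w * g ∈ W ∨ w * g = 0)
    {v : A} (hv : v ∈ Submodule.span ℂ W) : v * g ∈ Submodule.span ℂ W := by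
  induction hv using Submodule.span_induction with
  | mem x hx =>
    rcases H x hx with h | h
    · exact Submodule.subset_span h
    · rw [h]; exact zero_mem _
  | zero => rw [zero_mul]; exact zero_mem _
  | add x y _ _ hx hy => rw [add_mul]; exact add_mem hx hy
  | smul c x _ hx => rw [smul_mul_assoc]; exact Submodule.smul_mem _ _ hx

theorem pz_z (h : QRel p e1 e2 a b s) (hp : 1 ≤ p) {I J k : ℕ} {w : A}
    (h1 : PZ p (zc a b s) I J w) (hk : k ≤ p + 2) :
    ∃ I' J', PZ p (zc a b s) I' J' (w * zc a b s k) := by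
  rw [← (h1.comm (fun _ hl => h.zz hp hk hl)).eq]
  rcases Nat.lt_or_ge (p + 1) k with h3 | h3
  · obtain rfl : k = p + 2 := by omega
    exact ⟨_, _, .top _ _ _ _ _ h1 rfl rfl⟩
  · exact ⟨I + 2 * p + 3 - 2 * k, _, .mul k _ _ _ _ _ _ h3 h1 (by omega) rfl rfl⟩

theorem nf_z1 (h : QRel p e1 e2 a b s) (hp : 1 ≤ p) {I J k : ℕ} {w : A}
    (h1 : PZ p (zc a b s) I J w) (hk : k ≤ p + 2) :
    w * (zc a b s k * e1) ∈ nfset p e1 e2 a b s ∧ w * (zc a b s k * e2) ∈ nfset p e1 e2 a b s := by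
  obtain ⟨I', J', h2⟩ := h.pz_z hp h1 hk
  rw [← mul_assoc, ← mul_assoc]
  exact ⟨⟨_, _, _, _, .e1 _ _ _ h2⟩, ⟨_, _, _, _, .e2 _ _ _ h2⟩⟩

theorem nf_zz1 (h : QRel p e1 e2 a b s) (hp : 1 ≤ p) {I J k : ℕ} {w : A}
    (h1 : PZ p (zc a b s) I J w) (hk : k ≤ p + 2) :
    w * (zc a b s k * zc a b s k * e1) ∈ nfset p e1 e2 a b s ∧
    w * (zc a b s k * zc a b s k * e2) ∈ nfset p e1 e2 a b s := by
  obtain ⟨I', J', h2⟩ := h.pz_z hp h1 hk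
  rw [mul_assoc _ _ e1, mul_assoc _ _ e2, ← mul_assoc, ← mul_assoc w _ (_ * e2)]
  exact h.nf_z1 hp h2 hk

theorem nf_s (_h : QRel p e1 e2 a b s) {I J i : ℕ} {w : A}
    (h1 : PZ p (zc a b s) I J w) (hi : i ≤ p + 1) : w * s i ∈ nfset p e1 e2 a b s := by
  rcases Nat.lt_or_ge p i with h3 | h3
  · obtain rfl : i = p + 1 := by omega
    exact ⟨_, _, _, _, .st _ _ _ _ h1 rfl⟩
  · exact ⟨_, _, I + 2 * p + 1 - 2 * i, _, .s i _ _ _ _ _ h3 h1 (by omega) rfl⟩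

theorem nf_mul_e1 (h : QRel p e1 e2 a b s) :
    ∀ w ∈ nfset p e1 e2 a b s, w * e1 ∈ nfset p e1 e2 a b s ∨ w * e1 = 0 := by
  rintro w ⟨i, j, I, J, hw⟩
  have hw' := hw
  cases hw with
  | e1 _ _ w h1 => rw [mul_assoc, h.e11]; exact .inl ⟨_, _, _, _, hw'⟩
  | e2 _ _ w h1 => rw [mul_assoc, h.e21]; simp
  | a I J I' w h1 hI => rw [mul_assoc, h.ae1]; simp
  | b I J I' w h1 hI => rw [mul_assoc, h.be1]; simp
  | s i I J I' J' w hi h1 hI hJ =>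
    rw [mul_assoc, h.se1 (by omega)]; exact .inl ⟨_, _, _, _, hw'⟩
  | st I J J' w h1 hJ => rw [mul_assoc, h.se1 (by omega)]; exact .inl ⟨_, _, _, _, hw'⟩

theorem nf_mul_e2 (h : QRel p e1 e2 a b s) :
    ∀ w ∈ nfset p e1 e2 a b s, w * e2 ∈ nfset p e1 e2 a b s ∨ w * e2 = 0 := by
  rintro w ⟨i, j, I, J, hw⟩
  have hw' := hw
  cases hw with
  | e1 _ _ w h1 => rw [mul_assoc, h.e12]; simp
  | e2 _ _ w h1 => rw [mul_assoc, h.e22]; exact .inl ⟨_, _, _, _, hw'⟩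
  | a I J I' w h1 hI => rw [mul_assoc, h.ae2]; exact .inl ⟨_, _, _, _, hw'⟩
  | b I J I' w h1 hI => rw [mul_assoc, h.be2]; exact .inl ⟨_, _, _, _, hw'⟩
  | s i I J I' J' w hi h1 hI hJ => rw [mul_assoc, h.se2 (by omega)]; simp
  | st I J J' w h1 hJ => rw [mul_assoc, h.se2 (by omega)]; simp

theorem nf_mul_a (h : QRel p e1 e2 a b s) (hp : 1 ≤ p) :
    ∀ w ∈ nfset p e1 e2 a b s, w * a ∈ nfset p e1 e2 a b s ∨ w * a = 0 := by
  rintro w ⟨i, j, I, J, hw⟩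
  cases hw with
  | e1 _ _ w h1 => rw [mul_assoc, h.e1a]; exact .inl ⟨_, _, _, _, .a _ _ _ _ h1 rfl⟩
  | e2 _ _ w h1 => rw [mul_assoc, h.e2a]; simp
  | a I J I' w h1 hI => rw [mul_assoc, h.aa]; simp
  | b I J I' w h1 hI => rw [mul_assoc, h.ba]; simp
  | s i I J I' J' w hi h1 hI hJ =>
    rw [mul_assoc, h.sa_eq hi]; exact .inl (h.nf_z1 hp h1 (by omega)).2
  | st I J J' w h1 hJ =>
    rw [mul_assoc, h.sa_top]; exact .inl (h.nf_zz1 hp h1 (by omega)).2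

theorem nf_mul_b (h : QRel p e1 e2 a b s) (hp : 1 ≤ p) :
    ∀ w ∈ nfset p e1 e2 a b s, w * b ∈ nfset p e1 e2 a b s ∨ w * b = 0 := by
  rintro w ⟨i, j, I, J, hw⟩
  cases hw with
  | e1 _ _ w h1 => rw [mul_assoc, h.e1b]; exact .inl ⟨_, _, _, _, .b _ _ _ _ h1 rfl⟩
  | e2 _ _ w h1 => rw [mul_assoc, h.e2b]; simp
  | a I J I' w h1 hI => rw [mul_assoc, h.ab]; simp
  | b I J I' w h1 hI => rw [mul_assoc, h.bb]; simp
  | s i I J I' J' w hi h1 hI hJ =>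
    rw [mul_assoc, h.sb_eq (by omega)]; exact .inl (h.nf_z1 hp h1 (by omega)).2
  | st I J J' w h1 hJ =>
    rw [mul_assoc, h.sb_eq (by omega)]; exact .inl (h.nf_z1 hp h1 (by omega)).2

theorem nf_mul_s (h : QRel p e1 e2 a b s) (hp : 1 ≤ p) {k : ℕ} (hk : k ≤ p + 1) :
    ∀ w ∈ nfset p e1 e2 a b s, w * s k ∈ nfset p e1 e2 a b s ∨ w * s k = 0 := by
  rintro w ⟨i, j, I, J, hw⟩
  cases hw with
  | e1 _ _ w h1 => rw [mul_assoc, h.e1s hk]; simp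
  | e2 _ _ w h1 => rw [mul_assoc, h.e2s hk]; exact .inl (h.nf_s h1 hk)
  | a I J I' w h1 hI =>
    rw [mul_assoc]
    rcases Nat.lt_or_ge p k with h3 | h3
    · obtain rfl : k = p + 1 := by omega
      rw [h.as_top]; exact .inl (h.nf_zz1 hp h1 (by omega)).1
    · rw [h.as_eq h3]; exact .inl (h.nf_z1 hp h1 (by omega)).1
  | b I J I' w h1 hI =>
    rw [mul_assoc, h.bs_eq hk]; exact .inl (h.nf_z1 hp h1 (by omega)).1
  | s i I J I' J' w hi h1 hI hJ => rw [mul_assoc, h.ss (by omega) hk]; simp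
  | st I J J' w h1 hJ => rw [mul_assoc, h.ss (by omega) hk]; simp

end QRel

open MvPolynomial
set_option linter.all false

theorem PZ.map {A B : Type} [Ring A] [Ring B] (F : A →+* B) {p : ℕ} {z : ℕ → A} {I J : ℕ} {w : A}
    (h : PZ p z I J w) : PZ p (fun k => F (z k)) I J (F w) := by
  induction h with
  | one => rw [map_one]; exact .one
  | mul k I J I' J' w w' hk h hI hJ hw ih =>
    exact .mul k _ _ _ _ _ _ hk ih hI hJ (by rw [hw, map_mul])
  | top I J J' w w' h hJ hw ih => exact .top _ _ _ _ _ ih hJ (by rw [hw, map_mul])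

theorem zc_map {A B : Type} [Ring A] [Ring B] (F : A →+* B) (a b : A) (s : ℕ → A) :
    (fun k => F (zc a b s k)) = zc (F a) (F b) (fun k => F (s k)) := by
  funext k; cases k <;> simp [zc]

theorem NF.map {A B : Type} [Ring A] [Ring B] (F : A →+* B) {p : ℕ} {e1 e2 a b : A} {s : ℕ → A}
    {i j : Fin 2} {I J : ℕ} {w : A} (h : NF p e1 e2 a b s i j I J w) :
    NF p (F e1) (F e2) (F a) (F b) (fun k => F (s k)) i j I J (F w) := by
  have key : ∀ {I J : ℕ} {w : A}, PZ p (zc a b s) I J w →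
      PZ p (zc (F a) (F b) (fun k => F (s k))) I J (F w) := fun h => by
    rw [← zc_map]; exact h.map F
  cases h with
  | e1 _ _ w h1 => rw [map_mul]; exact .e1 _ _ _ (key h1)
  | e2 _ _ w h1 => rw [map_mul]; exact .e2 _ _ _ (key h1)
  | a I J I' w h1 hI => rw [map_mul]; exact .a _ _ _ _ (key h1) hI
  | b I J I' w h1 hI => rw [map_mul]; exact .b _ _ _ _ (key h1) hI
  | s i I J I' J' w hi h1 hI hJ =>
    rw [map_mul]; exact .s (s := fun k => F (s k)) i _ _ _ _ _ hi (key h1) hI hJ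
  | st I J J' w h1 hJ => rw [map_mul]; exact .st (s := fun k => F (s k)) _ _ _ _ (key h1) hJ

/-- monomials -/
noncomputable def mo (I J : ℕ) : MvPolynomial (Fin 2) ℂ := X 0 ^ I * X 1 ^ J

theorem mo_mul (I J I' J' : ℕ) : mo I J * mo I' J' = mo (I + I') (J + J') := by
  simp only [mo]; ring

theorem mo_eq (I J : ℕ) : mo I J = monomial (Finsupp.single 0 I + Finsupp.single 1 J) 1 := by
  simp only [mo, X_pow_eq_monomial, monomial_mul, one_mul]

abbrev Mat2 := Matrix (Fin 2) (Fin 2) (MvPolynomial (Fin 2) ℂ)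

noncomputable def mE1 : Mat2 := Matrix.single 0 0 1
noncomputable def mE2 : Mat2 := Matrix.single 1 1 1
noncomputable def mA : Mat2 := Matrix.single 0 1 (mo 2 0)
noncomputable def mB : Mat2 := Matrix.single 0 1 (mo 0 1)
noncomputable def mS (p i : ℕ) : Mat2 :=
  Matrix.single 1 0 (if i = p + 1 then mo 0 (2 * p + 2) else if i ≤ p then mo (2 * p + 1 - 2 * i) i else 0)

theorem mS_lt {p i : ℕ} (h : i ≤ p) : mS p i = Matrix.single 1 0 (mo (2 * p + 1 - 2 * i) i) := by
  rw [mS, if_neg (by omega), if_pos h]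
theorem mS_top {p : ℕ} : mS p (p + 1) = Matrix.single 1 0 (mo 0 (2 * p + 2)) := by
  rw [mS, if_pos rfl]

theorem mat_qrel (p : ℕ) : QRel p mE1 mE2 mA mB (mS p) where
  e11 := by simp [mE1]
  e22 := by simp [mE2]
  e12 := by simp [mE1, mE2]
  e21 := by simp [mE1, mE2]
  sum := by
    ext i j : 2
    fin_cases i <;> fin_cases j <;> simp [mE1, mE2]
  pa := by simp [mE1, mE2, mA]
  pb := by simp [mE1, mE2, mB]
  ps i hi := by simp [mE1, mE2, mS]
  sbs := by
    rw [mS_top, mS_lt le_rfl, mB]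
    simp only [Matrix.single_mul_single_same]
    rw [mul_right_comm]
    simp only [mo_mul]; congr 2 <;> omega
  asn := by
    rw [mS_top, mS_lt le_rfl, mB, mA, sq]
    simp only [Matrix.single_mul_single_same, mo_mul]
    congr 2 <;> omega
  sna := by
    rw [mS_top, mS_lt le_rfl, mB, mA, sq]
    simp only [Matrix.single_mul_single_same, mo_mul]
    congr 2 <;> omega
  as' i hi := by
    rw [mS_lt (by omega), mS_lt (by omega), mB, mA]
    simp only [Matrix.single_mul_single_same, mo_mul]
    congr 2 <;> omega
  sa' i hi := by
    rw [mS_lt (by omega), mS_lt (by omega), mB, mA]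
    simp only [Matrix.single_mul_single_same, mo_mul]
    congr 2 <;> omega

/-- diagonal -/
noncomputable def dg (f : MvPolynomial (Fin 2) ℂ) : Mat2 :=
  Matrix.single 0 0 f + Matrix.single 1 1 f

theorem dg_mul_single (f g : MvPolynomial (Fin 2) ℂ) (i j : Fin 2) :
    dg f * Matrix.single i j g = Matrix.single i j (f * g) := by
  fin_cases i <;> simp [dg, add_mul]

theorem dg_mul (f g : MvPolynomial (Fin 2) ℂ) : dg f * dg g = dg (f * g) := by
  conv_lhs => rw [dg.eq_def g]
  rw [mul_add, dg_mul_single, dg_mul_single, dg]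

theorem dg_one : dg 1 = 1 := (mat_qrel 0).sum

theorem zm {p k : ℕ} (hk : k ≤ p + 1) : zc mA mB (mS p) k = dg (mo (2 * p + 3 - 2 * k) k) := by
  rcases k with _ | k
  · simp only [zc]
    rw [mS_lt (by omega), mA, dg]
    simp only [Matrix.single_mul_single_same, mo_mul]
    congr 3 <;> omega
  · simp only [zc]
    rw [mS_lt (by omega), mB, dg]
    simp only [Matrix.single_mul_single_same, mo_mul]
    congr 3 <;> omega

theorem zm_top {p : ℕ} : zc mA mB (mS p) (p + 2) = dg (mo 0 (2 * p + 3)) := by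
  simp only [zc]
  rw [mS_top, mB, dg]
  simp only [Matrix.single_mul_single_same, mo_mul]
  congr 3; omega

theorem pz_mat {p I J : ℕ} {w : Mat2} (h : PZ p (zc mA mB (mS p)) I J w) : w = dg (mo I J) := by
  induction h with
  | one => simp [mo, dg_one]
  | mul k I J I' J' w w' hk h hI hJ hw ih =>
    rw [hw, ih, zm hk, dg_mul, mo_mul]; congr 2 <;> omega
  | top I J J' w w' h hJ hw ih =>
    rw [hw, ih, zm_top, dg_mul, mo_mul]; congr 2 <;> omega

theorem nf_mat {p I J : ℕ} {i j : Fin 2} {w : Mat2} (h : NF p mE1 mE2 mA mB (mS p) i j I J w) :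
    w = Matrix.single i j (mo I J) := by
  cases h with
  | e1 _ _ w h1 => rw [pz_mat h1, mE1, dg_mul_single, mul_one]
  | e2 _ _ w h1 => rw [pz_mat h1, mE2, dg_mul_single, mul_one]
  | a I J I' w h1 hI => rw [pz_mat h1, mA, dg_mul_single, mo_mul, hI]; rfl
  | b I J I' w h1 hI => rw [pz_mat h1, mB, dg_mul_single, mo_mul, hI]; rfl
  | s i I J I' J' w hi h1 hI hJ =>
    rw [pz_mat h1, mS_lt hi, dg_mul_single, mo_mul]; congr 2 <;> omega
  | st I J J' w h1 hJ =>
    rw [pz_mat h1, mS_top, dg_mul_single, mo_mul]; congr 2; omega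

/-- matrix units times monomials are linearly independent -/
theorem li_mat : LinearIndependent ℂ
    (fun t : Fin 2 × Fin 2 × ℕ × ℕ => (Matrix.single t.1 t.2.1 (mo t.2.2.1 t.2.2.2) : Mat2)) := by
  have hb := ((basisMonomials (Fin 2) ℂ).matrix (Fin 2) (Fin 2)).linearIndependent
  have := hb.comp (fun t : Fin 2 × Fin 2 × ℕ × ℕ =>
    (t.1, t.2.1, (Finsupp.single 0 t.2.2.1 + Finsupp.single 1 t.2.2.2 : Fin 2 →₀ ℕ))) (by
      rintro ⟨i, j, I, J⟩ ⟨i', j', I', J'⟩ h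
      simp only [Prod.mk.injEq] at h
      obtain ⟨rfl, rfl, h⟩ := h
      have h0 := DFunLike.congr_fun h 0
      have h1 := DFunLike.congr_fun h 1
      simp at h0 h1
      simp [h0, h1])
  have e : (fun t : Fin 2 × Fin 2 × ℕ × ℕ =>
      (Matrix.single t.1 t.2.1 (mo t.2.2.1 t.2.2.2) : Mat2)) = ((basisMonomials (Fin 2) ℂ).matrix (Fin 2) (Fin 2)) ∘
      (fun t => (t.1, t.2.1,
        (Finsupp.single 0 t.2.2.1 + Finsupp.single 1 t.2.2.2 : Fin 2 →₀ ℕ))) := by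
    funext t
    simp [mo_eq]
  rw [e]
  exact this

theorem inj_of_nf {A : Type} [Ring A] [Algebra ℂ A] {ι κ M : Type} [AddCommGroup M] [Module ℂ M]
    (F : A →ₗ[ℂ] M) (W : ι → A) (d : ι → κ) (B : κ → M) (hB : LinearIndependent ℂ B)
    (hW : ⊤ ≤ Submodule.span ℂ (Set.range W)) (hF : ∀ i, F (W i) = B (d i))
    (hd : ∀ i j, d i = d j → W i = W j) : Function.Injective F := by
  classical
  rw [injective_iff_map_eq_zero]
  intro x hx
  obtain ⟨c, rfl⟩ := (Finsupp.mem_span_range_iff_exists_finsupp).1 (hW (Submodule.mem_top (x := x)))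
  let W' : κ → A := fun t => if h : ∃ i, d i = t then W h.choose else 0
  have hW' : W = W' ∘ d := by
    funext i
    have h : ∃ i', d i' = d i := ⟨i, rfl⟩
    simp only [W', Function.comp, dif_pos h]
    exact (hd _ _ h.choose_spec).symm
  have h1 : (c.sum fun i r => r • W i) = Finsupp.linearCombination ℂ W c := rfl
  rw [h1] at hx ⊢
  rw [hW', ← Finsupp.linearCombination_mapDomain]
  have : Finsupp.mapDomain d c = 0 := by
    apply (linearIndependent_iff.1 hB)
    rw [Finsupp.linearCombination_mapDomain, ← hx, Finsupp.apply_linearCombination]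
    congr 2
    funext i
    exact (hF i).symm
  rw [this, map_zero]

theorem QRel.inj {A : Type} [Ring A] [Algebra ℂ A] {p : ℕ} {e1 e2 a b : A} {s : ℕ → A}
    (h : QRel p e1 e2 a b s) (hp : 1 ≤ p) (hW : ⊤ ≤ Submodule.span ℂ (nfset p e1 e2 a b s))
    (F : A →ₐ[ℂ] Mat2) (h1 : F e1 = mE1) (h2 : F e2 = mE2) (ha : F a = mA) (hb : F b = mB)
    (hs : ∀ i, F (s i) = mS p i) : Function.Injective F := by
  let ι := {q : (Fin 2 × Fin 2 × ℕ × ℕ) × A // NF p e1 e2 a b s q.1.1 q.1.2.1 q.1.2.2.1 q.1.2.2.2 q.2}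
  refine inj_of_nf F.toLinearMap (fun q : ι => q.1.2) (fun q : ι => q.1.1) _ li_mat ?_ ?_ ?_
  · refine hW.trans (Submodule.span_mono ?_)
    rintro w ⟨i, j, I, J, hw⟩
    exact ⟨⟨((i, j, I, J), w), hw⟩, rfl⟩
  · rintro ⟨⟨⟨i, j, I, J⟩, w⟩, hw⟩
    have := hw.map F.toRingHom
    have e : (fun k => F.toRingHom (s k)) = mS p := funext hs
    rw [e] at this
    simp only [AlgHom.toRingHom_eq_coe, RingHom.coe_coe, h1, h2, ha, hb] at this
    exact nf_mat this
  · rintro ⟨⟨⟨i, j, I, J⟩, w⟩, hw⟩ ⟨⟨⟨i', j', I', J'⟩, w'⟩, hw'⟩ he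
    simp only [Prod.mk.injEq] at he
    obtain ⟨rfl, rfl, rfl, rfl⟩ := he
    exact h.nf_uniq hp hw hw'

section surj
variable {p : ℕ} (Rg : Subalgebra ℂ Mat2)

theorem scal_mem (hA : mA ∈ Rg) (hB : mB ∈ Rg) (hS : ∀ i ≤ p + 1, mS p i ∈ Rg) (N : ℕ) :
    ∀ I J, I + J = N → (2 * p + 3) ∣ I + 2 * J → dg (mo I J) ∈ Rg := by
  have hz : ∀ k ≤ p + 2, zc mA mB (mS p) k ∈ Rg := by
    intro k hk
    rcases k with _ | k
    · exact add_mem (mul_mem hA (hS 0 (by omega))) (mul_mem (hS 0 (by omega)) hA)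
    · exact add_mem (mul_mem hB (hS k (by omega))) (mul_mem (hS k (by omega)) hB)
  induction N using Nat.strong_induction_on with
  | _ N ih =>
    intro I J hN hd
    by_cases h0 : I + J = 0
    · obtain ⟨rfl, rfl⟩ : I = 0 ∧ J = 0 := by omega
      have : mo 0 0 = 1 := by simp [mo]
      rw [this, dg_one]; exact one_mem _
    have key : ∀ k ≤ p + 1, k ≤ J → 2 * p + 3 ≤ I + 2 * k → dg (mo I J) ∈ Rg := by
      intro k hk h1 h2
      have h3 : dg (mo (I + 2 * k - (2 * p + 3)) (J - k)) ∈ Rg := by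
        refine ih _ ?_ _ _ rfl ?_
        · omega
        · have : I + 2 * J = (I + 2 * k - (2 * p + 3) + 2 * (J - k)) + (2 * p + 3) := by omega
          rw [this] at hd
          exact (Nat.dvd_add_left dvd_rfl).1 hd
      have h4 := mul_mem (hz k (by omega)) h3
      rw [zm hk, dg_mul, mo_mul] at h4
      convert h4 using 3 <;> omega
    obtain ⟨c, hc⟩ := hd
    have hc0 : 1 ≤ c := by
      rcases c with _ | c
      · omega
      · omega
    by_cases hJ : J ≤ p
    · refine key J (by omega) le_rfl ?_
      have : (2 * p + 3) * 1 ≤ (2 * p + 3) * c := Nat.mul_le_mul_left _ hc0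
      omega
    by_cases hI : 1 ≤ I
    · exact key (p + 1) le_rfl (by omega) (by omega)
    have hI0 : I = 0 := by omega
    subst hI0
    have hdJ : (2 * p + 3) ∣ J := by
      refine Nat.Coprime.dvd_of_dvd_mul_left (m := 2) ?_ ⟨c, by omega⟩
      rw [Nat.coprime_comm]
      exact (Nat.coprime_two_left).2 ⟨p + 1, by ring⟩
    have hle := Nat.le_of_dvd (by omega) hdJ
    have h3 : dg (mo 0 (J - (2 * p + 3))) ∈ Rg := by
      refine ih _ ?_ _ _ rfl ?_
      · omega
      · rw [zero_add]
        exact Dvd.dvd.mul_left (Nat.dvd_sub hdJ dvd_rfl) 2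
    have h4 := mul_mem (hz (p + 2) (by omega)) h3
    rw [zm_top, dg_mul, mo_mul] at h4
    convert h4 using 3; omega

theorem single_mem (hE1 : mE1 ∈ Rg) (hE2 : mE2 ∈ Rg)
    (hA : mA ∈ Rg) (hB : mB ∈ Rg) (hS : ∀ i ≤ p + 1, mS p i ∈ Rg) (i j : Fin 2) (I J : ℕ)
    (h : 2 * (i : ℕ) + (I + 2 * J) ≡ 2 * (j : ℕ) [MOD (2 * p + 3)]) :
    Matrix.single i j (mo I J) ∈ Rg := by
  have hsc := fun I J => scal_mem Rg hA hB hS _ I J rfl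
  have key : ∀ i j I0 J0 I1 J1, Matrix.single i j (mo I1 J1) ∈ Rg →
      (2 * p + 3) ∣ I0 + 2 * J0 → I = I0 + I1 → J = J0 + J1 → Matrix.single i j (mo I J) ∈ Rg := by
    intro i j I0 J0 I1 J1 h1 h2 h3 h4
    have := mul_mem (hsc I0 J0 h2) h1
    rw [dg_mul_single, mo_mul] at this
    rw [h3, h4]; exact this
  have one : mo 0 0 = 1 := by simp [mo]
  fin_cases i <;> fin_cases j
  · refine key 0 0 I J 0 0 (by rw [one]; exact hE1) ?_ rfl rfl
    have := (Nat.modEq_zero_iff_dvd).1 h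
    simpa using this
  · simp only [Fin.zero_eta, Fin.isValue, Fin.val_zero, mul_zero, zero_add, Fin.mk_one,
      Fin.val_one, mul_one] at h ⊢
    rcases Nat.eq_zero_or_pos J with hJ | hJ
    · subst hJ
      have hI : 2 ≤ I := by
        by_contra hI
        have := Nat.ModEq.eq_of_lt_of_lt h (by omega) (by omega)
        omega
      refine key 0 1 (I - 2) 0 2 0 hA ?_ (by omega) rfl
      have := (Nat.modEq_iff_dvd' (by omega)).1 h.symm
      convert this using 1; omega
    · refine key 0 1 I (J - 1) 0 1 hB ?_ rfl (by omega)
      have := (Nat.modEq_iff_dvd' (by omega)).1 h.symm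
      convert this using 1; omega
  · simp only [Fin.zero_eta, Fin.isValue, Fin.val_zero, mul_zero, Fin.mk_one,
      Fin.val_one, mul_one] at h ⊢
    have hd := (Nat.modEq_zero_iff_dvd).1 h
    have hle := Nat.le_of_dvd (by omega) hd
    have key2 : ∀ k ≤ p, k ≤ J → 2 * p + 1 ≤ I + 2 * k → Matrix.single 1 0 (mo I J) ∈ Rg := by
      intro k hk h1 h2
      refine key 1 0 (I + 2 * k - (2 * p + 1)) (J - k) (2 * p + 1 - 2 * k) k ?_ ?_ (by omega)
        (by omega)
      · rw [← mS_lt hk]; exact hS k (by omega)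
      · have : 2 + (I + 2 * J) = (I + 2 * k - (2 * p + 1) + 2 * (J - k)) + (2 * p + 3) := by omega
        rw [this] at hd
        exact (Nat.dvd_add_left dvd_rfl).1 hd
    by_cases hJ : J ≤ p
    · exact key2 J hJ le_rfl (by omega)
    by_cases hI : 1 ≤ I
    · exact key2 p le_rfl (by omega) (by omega)
    have hI0 : I = 0 := by omega
    subst hI0
    have hdJ : (2 * p + 3) ∣ J + 1 := by
      refine Nat.Coprime.dvd_of_dvd_mul_left (m := 2) ?_ ?_
      · rw [Nat.coprime_comm]
        exact (Nat.coprime_two_left).2 ⟨p + 1, by ring⟩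
      · convert hd using 1; omega
    have hle := Nat.le_of_dvd (by omega) hdJ
    refine key 1 0 0 (J - (2 * p + 2)) 0 (2 * p + 2) ?_ ?_ rfl (by omega)
    · rw [← mS_top]; exact hS _ le_rfl
    · rw [zero_add]
      refine Dvd.dvd.mul_left ?_ 2
      have := Nat.dvd_sub hdJ (dvd_refl (2 * p + 3))
      rwa [show J - (2 * p + 2) = J + 1 - (2 * p + 3) by omega]
  · refine key 1 1 I J 0 0 (by rw [one]; exact hE2) ?_ rfl rfl
    simp only [Fin.mk_one, Fin.isValue, Fin.val_one, mul_one] at h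
    have := (Nat.modEq_iff_dvd' (by omega)).1 h.symm
    convert this using 1; omega
end surj

/-- twisted-invariant matrices -/
def TT (ε : ℂ) (σ : MvPolynomial (Fin 2) ℂ →ₐ[ℂ] MvPolynomial (Fin 2) ℂ) : Subalgebra ℂ Mat2 where
  carrier := {M | ∀ i j : Fin 2, C (ε ^ (2 * (i : ℕ))) * σ (M i j) = C (ε ^ (2 * (j : ℕ))) * M i j}
  mul_mem' := by
    intro M N hM hN i j
    simp only [Matrix.mul_apply, map_sum, map_mul, Finset.mul_sum]
    refine Finset.sum_congr rfl fun k _ => ?_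
    rw [← mul_assoc, hM i k, mul_right_comm, hN k j]; ring
  add_mem' := by
    intro M N hM hN i j
    rw [Matrix.add_apply, map_add, mul_add, mul_add, hM i j, hN i j]
  algebraMap_mem' := by
    intro c i j
    rw [Matrix.algebraMap_matrix_apply]
    split_ifs with h
    · rw [h, AlgHom.commutes]
    · simp

theorem sigma_mo {ε : ℂ} {σ : MvPolynomial (Fin 2) ℂ →ₐ[ℂ] MvPolynomial (Fin 2) ℂ}
    (hσx : σ (X 0) = C ε * X 0) (hσy : σ (X 1) = C (ε ^ 2) * X 1) (I J : ℕ) :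
    σ (mo I J) = C (ε ^ (I + 2 * J)) * mo I J := by
  simp only [mo, map_mul, map_pow, hσx, hσy]; ring

theorem sigma_coeff {ε : ℂ} {σ : MvPolynomial (Fin 2) ℂ →ₐ[ℂ] MvPolynomial (Fin 2) ℂ}
    (hσx : σ (X 0) = C ε * X 0) (hσy : σ (X 1) = C (ε ^ 2) * X 1) (f : MvPolynomial (Fin 2) ℂ)
    (d : Fin 2 →₀ ℕ) : coeff d (σ f) = ε ^ (d 0 + 2 * d 1) * coeff d f := by
  induction f using MvPolynomial.induction_on' with
  | monomial u r =>
    have hu : u = Finsupp.single 0 (u 0) + Finsupp.single 1 (u 1) := by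
      ext k; fin_cases k <;> simp
    have : monomial u r = C r * mo (u 0) (u 1) := by
      rw [mo_eq, ← hu, C_mul_monomial, mul_one]
    rw [this, map_mul, sigma_mo hσx hσy, algHom_C, algebraMap_eq, coeff_C_mul, coeff_C_mul,
      coeff_C_mul, mo_eq, ← hu, coeff_monomial]
    split_ifs with h
    · rw [h]; ring
    · simp
  | add f g hf hg => rw [map_add, coeff_add, coeff_add, hf, hg]; ring

theorem prim_pow_iff {k : ℕ} (hk : 0 < k) {ε : ℂ} (hε : IsPrimitiveRoot ε k) (i j : ℕ) :
    ε ^ i = ε ^ j ↔ i ≡ j [MOD k] := by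
  rw [pow_eq_pow_mod i hε.pow_eq_one, pow_eq_pow_mod j hε.pow_eq_one]
  exact ⟨fun h => hε.pow_inj (Nat.mod_lt _ hk) (Nat.mod_lt _ hk) h, fun h => by rw [h]⟩

theorem TT_le {p : ℕ} {ε : ℂ} (hε : IsPrimitiveRoot ε (2 * p + 3))
    {σ : MvPolynomial (Fin 2) ℂ →ₐ[ℂ] MvPolynomial (Fin 2) ℂ}
    (hσx : σ (X 0) = C ε * X 0) (hσy : σ (X 1) = C (ε ^ 2) * X 1) (Rg : Subalgebra ℂ Mat2)
    (hE1 : mE1 ∈ Rg) (hE2 : mE2 ∈ Rg)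
    (hA : mA ∈ Rg) (hB : mB ∈ Rg) (hS : ∀ i ≤ p + 1, mS p i ∈ Rg) : TT ε σ ≤ Rg := by
  intro M hM
  rw [Matrix.matrix_eq_sum_single M]
  refine sum_mem fun i _ => sum_mem fun j _ => ?_
  rw [(M i j).as_sum]
  have : ∀ f : Finset (Fin 2 →₀ ℕ), Matrix.single i j (∑ v ∈ f, monomial v (coeff v (M i j))) =
    ∑ v ∈ f, (Matrix.single i j (monomial v (coeff v (M i j))) : Mat2) := fun f =>
      map_sum (Matrix.singleAddMonoidHom i j) _ _
  rw [this]
  refine sum_mem fun u hu => ?_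
  have hu' : u = Finsupp.single 0 (u 0) + Finsupp.single 1 (u 1) := by
    ext k; fin_cases k <;> simp
  have e : (Matrix.single i j (monomial u (coeff u (M i j))) : Mat2) =
      (coeff u (M i j)) • Matrix.single i j (mo (u 0) (u 1)) := by
    rw [mo_eq, ← hu', Matrix.smul_single, smul_monomial, smul_eq_mul, mul_one]
  rw [e]
  refine Subalgebra.smul_mem _ (single_mem Rg hE1 hE2 hA hB hS i j _ _ ?_) _
  have h1 := congrArg (coeff u) (hM i j)
  rw [coeff_C_mul, coeff_C_mul, sigma_coeff hσx hσy, ← mul_assoc, ← pow_add] at h1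
  have h2 := mul_right_cancel₀ (mem_support_iff.1 hu) h1
  exact (prim_pow_iff (by omega) hε _ _).1 h2

theorem single_mem_TT {p : ℕ} {ε : ℂ} (hε : IsPrimitiveRoot ε (2 * p + 3))
    {σ : MvPolynomial (Fin 2) ℂ →ₐ[ℂ] MvPolynomial (Fin 2) ℂ}
    (hσx : σ (X 0) = C ε * X 0) (hσy : σ (X 1) = C (ε ^ 2) * X 1) (i j : Fin 2) (I J : ℕ)
    (h : 2 * (i : ℕ) + (I + 2 * J) ≡ 2 * (j : ℕ) [MOD (2 * p + 3)]) :
    Matrix.single i j (mo I J) ∈ TT ε σ := by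
  intro i' j'
  rw [Matrix.single_apply]
  split_ifs with h1
  · obtain ⟨rfl, rfl⟩ := h1
    rw [sigma_mo hσx hσy, ← mul_assoc, ← C_mul, ← pow_add]
    rw [(prim_pow_iff (by omega) hε _ _).2 h]
  · simp

open MvPolynomial

noncomputable def mkL (n : ℕ) : FreeAlgebra ℂ (Fin (n + 4)) →ₐ[ℂ] Lambda n :=
  RingQuot.mkAlgHom ℂ (LambdaRel n)

theorem mkL_surj (n : ℕ) : Function.Surjective (mkL n) := RingQuot.mkAlgHom_surjective ℂ _

theorem mkL_rel {n : ℕ} {x y : FreeAlgebra ℂ (Fin (n + 4))} (h : LambdaRel n x y) :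
    mkL n x = mkL n y := RingQuot.mkAlgHom_rel ℂ h

noncomputable def sL (p : ℕ) (i : ℕ) : Lambda (p + 2) :=
  if h : i < p + 2 then mkL (p + 2) (ps (p + 2) ⟨i, h⟩) else 0

theorem sL_eq {p i : ℕ} (h : i < p + 2) : sL p i = mkL (p + 2) (ps (p + 2) ⟨i, h⟩) := dif_pos h

theorem lambda_qrel (p : ℕ) (hp : 1 ≤ p) : QRel p (mkL (p + 2) (pe1 _)) (mkL (p + 2) (pe2 _))
    (mkL (p + 2) (pa _)) (mkL (p + 2) (pb _)) (sL p) where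
  e11 := by simpa using mkL_rel (LambdaRel.e1_idem (n := p + 2))
  e22 := by simpa using mkL_rel (LambdaRel.e2_idem (n := p + 2))
  e12 := by simpa using mkL_rel (LambdaRel.orth12 (n := p + 2))
  e21 := by simpa using mkL_rel (LambdaRel.orth21 (n := p + 2))
  sum := by simpa using mkL_rel (LambdaRel.sum_idem (n := p + 2))
  pa := by simpa using mkL_rel (LambdaRel.path_a (n := p + 2))
  pb := by simpa using mkL_rel (LambdaRel.path_b (n := p + 2))
  ps i hi := by
    rw [sL_eq (by omega)]
    simpa using mkL_rel (LambdaRel.path_s (n := p + 2) ⟨i, by omega⟩)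
  sbs := by
    rw [sL_eq (by omega), sL_eq (by omega)]
    simpa using mkL_rel (LambdaRel.rel_sbs (n := p + 2) (by omega))
  asn := by
    rw [sL_eq (by omega), sL_eq (by omega)]
    simpa using mkL_rel (LambdaRel.rel_asn (n := p + 2) (by omega))
  sna := by
    rw [sL_eq (by omega), sL_eq (by omega)]
    simpa using mkL_rel (LambdaRel.rel_sna (n := p + 2) (by omega))
  as' i hi := by
    rw [sL_eq (by omega), sL_eq (by omega)]
    simpa using mkL_rel (LambdaRel.rel_as (n := p + 2) (i + 1) (by omega) (by omega))
  sa' i hi := by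
    rw [sL_eq (by omega), sL_eq (by omega)]
    simpa using mkL_rel (LambdaRel.rel_sa (n := p + 2) (i + 1) (by omega) (by omega))

noncomputable def genM (p : ℕ) (k : Fin (p + 2 + 4)) : Mat2 :=
  if (k : ℕ) = 0 then mE1 else if (k : ℕ) = 1 then mE2 else if (k : ℕ) = 2 then mA else
    if (k : ℕ) = 3 then mB else mS p (k - 4)

noncomputable def freeM (p : ℕ) : FreeAlgebra ℂ (Fin (p + 2 + 4)) →ₐ[ℂ] Mat2 :=
  FreeAlgebra.lift ℂ (genM p)

theorem freeM_e1 (p : ℕ) : freeM p (pe1 _) = mE1 := by simp [freeM, pe1, genM]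
theorem freeM_e2 (p : ℕ) : freeM p (pe2 _) = mE2 := by
  simp only [freeM, pe2, FreeAlgebra.lift_ι_apply]; rfl
theorem freeM_a (p : ℕ) : freeM p (pa _) = mA := by
  simp only [freeM, pa, FreeAlgebra.lift_ι_apply]; rfl
theorem freeM_b (p : ℕ) : freeM p (pb _) = mB := by
  simp only [freeM, pb, FreeAlgebra.lift_ι_apply]; rfl
theorem freeM_s (p : ℕ) (i : Fin (p + 2)) : freeM p (ps _ i) = mS p i := by
  simp only [freeM, ps, FreeAlgebra.lift_ι_apply, genM]
  rw [if_neg (by omega), if_neg (by omega), if_neg (by omega), if_neg (by omega)]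
  congr 1; omega

theorem freeM_rel (p : ℕ) {x y : FreeAlgebra ℂ (Fin (p + 2 + 4))} (h : LambdaRel (p + 2) x y) :
    freeM p x = freeM p y := by
  have q := mat_qrel p
  cases h with
  | e1_idem => simpa [freeM_e1] using q.e11
  | e2_idem => simpa [freeM_e2] using q.e22
  | orth12 => simpa [freeM_e1, freeM_e2] using q.e12
  | orth21 => simpa [freeM_e1, freeM_e2] using q.e21
  | sum_idem => simpa [freeM_e1, freeM_e2] using q.sum
  | path_a => simpa [freeM_e1, freeM_e2, freeM_a] using q.pa
  | path_b => simpa [freeM_e1, freeM_e2, freeM_b] using q.pb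
  | path_s i => simpa [freeM_e1, freeM_e2, freeM_s] using q.ps i (by omega)
  | rel_sbs h => simpa [freeM_b, freeM_s] using q.sbs
  | rel_asn h => simpa [freeM_a, freeM_b, freeM_s] using q.asn
  | rel_sna h => simpa [freeM_a, freeM_b, freeM_s] using q.sna
  | rel_as i h1 h2 =>
    obtain ⟨i, rfl⟩ := Nat.exists_eq_add_of_le' h1
    simpa [freeM_a, freeM_b, freeM_s] using q.as' i (by omega)
  | rel_sa i h1 h2 =>
    obtain ⟨i, rfl⟩ := Nat.exists_eq_add_of_le' h1
    simpa [freeM_a, freeM_b, freeM_s] using q.sa' i (by omega)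

noncomputable def lamM (p : ℕ) : Lambda (p + 2) →ₐ[ℂ] Mat2 :=
  RingQuot.liftAlgHom ℂ ⟨freeM p, fun _ _ h => freeM_rel p h⟩

theorem lamM_mk (p : ℕ) (x : FreeAlgebra ℂ (Fin (p + 2 + 4))) : lamM p (mkL _ x) = freeM p x :=
  RingQuot.liftAlgHom_mkAlgHom_apply ℂ (freeM p) (fun _ _ h => freeM_rel p h) x

theorem lambda_span (p : ℕ) (hp : 1 ≤ p) : ⊤ ≤ Submodule.span ℂ
    (QRel.nfset p (mkL (p + 2) (pe1 _)) (mkL (p + 2) (pe2 _))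
    (mkL (p + 2) (pa _)) (mkL (p + 2) (pb _)) (sL p)) := by
  have q := lambda_qrel p hp
  have key : ∀ x : FreeAlgebra ℂ (Fin (p + 2 + 4)), ∀ v ∈ Submodule.span ℂ
    (QRel.nfset p (mkL (p + 2) (pe1 _)) (mkL (p + 2) (pe2 _))
    (mkL (p + 2) (pa _)) (mkL (p + 2) (pb _)) (sL p)), v * mkL _ x ∈ Submodule.span ℂ
    (QRel.nfset p (mkL (p + 2) (pe1 _)) (mkL (p + 2) (pe2 _))
    (mkL (p + 2) (pa _)) (mkL (p + 2) (pb _)) (sL p)) := by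
    intro x
    induction x using FreeAlgebra.induction with
    | grade0 r =>
      intro v hv
      rw [AlgHom.commutes, ← Algebra.commutes, ← Algebra.smul_def]
      exact Submodule.smul_mem _ _ hv
    | grade1 k =>
      intro v hv
      obtain ⟨k, hk⟩ := k
      match k with
      | 0 => exact QRel.span_mul q.nf_mul_e1 hv
      | 1 => exact QRel.span_mul q.nf_mul_e2 hv
      | 2 => exact QRel.span_mul (q.nf_mul_a hp) hv
      | 3 => exact QRel.span_mul (q.nf_mul_b hp) hv
      | k + 4 =>
        have e : mkL (p + 2) (FreeAlgebra.ι ℂ ⟨k + 4, hk⟩) = sL p k := by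
          rw [sL_eq (by omega), ps]; congr 3; simp [add_comm]
        rw [e]
        exact QRel.span_mul (q.nf_mul_s hp (by omega)) hv
    | mul x y hx hy => intro v hv; rw [map_mul, ← mul_assoc]; exact hy _ (hx _ hv)
    | add x y hx hy => intro v hv; rw [map_add, mul_add]; exact add_mem (hx _ hv) (hy _ hv)
  intro x _
  obtain ⟨x, rfl⟩ := mkL_surj _ x
  simpa using key x 1 q.nf_one

theorem lamM_s (p i : ℕ) : lamM p (sL p i) = mS p i := by
  by_cases h : i < p + 2
  · rw [sL_eq h, lamM_mk, freeM_s]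
  · rw [sL, dif_neg h, map_zero, mS, if_neg (by omega), if_neg (by omega)]; simp

theorem lamM_inj (p : ℕ) (hp : 1 ≤ p) : Function.Injective (lamM p) :=
  (lambda_qrel p hp).inj hp (lambda_span p hp) (lamM p) (by rw [lamM_mk, freeM_e1])
    (by rw [lamM_mk, freeM_e2]) (by rw [lamM_mk, freeM_a]) (by rw [lamM_mk, freeM_b]) (lamM_s p)

theorem gen_mem_TT {p : ℕ} {ε : ℂ} (hε : IsPrimitiveRoot ε (2 * p + 3))
    {σ : MvPolynomial (Fin 2) ℂ →ₐ[ℂ] MvPolynomial (Fin 2) ℂ}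
    (hσx : σ (X 0) = C ε * X 0) (hσy : σ (X 1) = C (ε ^ 2) * X 1) (k : Fin (p + 2 + 4)) :
    genM p k ∈ TT ε σ := by
  have key := single_mem_TT hε hσx hσy
  have one : mo 0 0 = 1 := by simp [mo]
  rw [genM]
  split_ifs
  · rw [mE1, ← one]; exact key 0 0 0 0 rfl
  · rw [mE2, ← one]; exact key 1 1 0 0 rfl
  · exact key 0 1 2 0 rfl
  · exact key 0 1 0 1 rfl
  · rcases Nat.lt_or_ge p (k - 4) with h | h
    · rw [show (k : ℕ) - 4 = p + 1 by omega, mS_top]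
      refine key 1 0 _ _ ((Nat.modEq_zero_iff_dvd).2 ⟨2, ?_⟩)
      simp; ring
    · rw [mS_lt h]
      refine key 1 0 _ _ ((Nat.modEq_zero_iff_dvd).2 ⟨1, ?_⟩)
      simp; omega

theorem lamM_range {p : ℕ} {ε : ℂ} (hε : IsPrimitiveRoot ε (2 * p + 3))
    {σ : MvPolynomial (Fin 2) ℂ →ₐ[ℂ] MvPolynomial (Fin 2) ℂ}
    (hσx : σ (X 0) = C ε * X 0) (hσy : σ (X 1) = C (ε ^ 2) * X 1) :
    (lamM p).range = TT ε σ := by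
  apply le_antisymm
  · rintro _ ⟨x, rfl⟩
    obtain ⟨x, rfl⟩ := mkL_surj _ x
    change lamM p (mkL _ x) ∈ TT ε σ
    rw [lamM_mk]
    induction x using FreeAlgebra.induction with
    | grade0 r => rw [AlgHom.commutes]; exact Subalgebra.algebraMap_mem _ _
    | grade1 k =>
      simp only [freeM, FreeAlgebra.lift_ι_apply]
      exact gen_mem_TT hε hσx hσy k
    | mul x y hx hy => rw [map_mul]; exact mul_mem hx hy
    | add x y hx hy => rw [map_add]; exact add_mem hx hy
  · apply TT_le hε hσx hσy
    · exact ⟨_, (lamM_mk p _).trans (freeM_e1 p)⟩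
    · exact ⟨_, (lamM_mk p _).trans (freeM_e2 p)⟩
    · exact ⟨_, (lamM_mk p _).trans (freeM_a p)⟩
    · exact ⟨_, (lamM_mk p _).trans (freeM_b p)⟩
    · exact fun i _ => ⟨_, lamM_s p i⟩

theorem lambda_equiv_TT {p : ℕ} (hp : 1 ≤ p) {ε : ℂ} (hε : IsPrimitiveRoot ε (2 * p + 3))
    {σ : MvPolynomial (Fin 2) ℂ →ₐ[ℂ] MvPolynomial (Fin 2) ℂ}
    (hσx : σ (X 0) = C ε * X 0) (hσy : σ (X 1) = C (ε ^ 2) * X 1) :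
    Nonempty (Lambda (p + 2) ≃ₐ[ℂ] TT ε σ) :=
  ⟨(AlgEquiv.ofInjective (lamM p) (lamM_inj p hp)).trans
    (Subalgebra.equivOfEq _ _ (lamM_range hε hσx hσy))⟩

open MvPolynomial
set_option linter.all false


theorem sigma_monomial {ε : ℂ} {σ : MvPolynomial (Fin 2) ℂ →ₐ[ℂ] MvPolynomial (Fin 2) ℂ}
    (hσx : σ (X 0) = C ε * X 0) (hσy : σ (X 1) = C (ε ^ 2) * X 1) (I J : ℕ) (c : ℂ) :
    σ (C c * mo I J) = C (ε ^ (I + 2 * J)) * (C c * mo I J) := by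
  rw [map_mul, sigma_mo hσx hσy, algHom_C, algebraMap_eq]; ring

theorem monomial_eq_mo (d : Fin 2 →₀ ℕ) (c : ℂ) : monomial d c = C c * mo (d 0) (d 1) := by
  have hu : d = Finsupp.single 0 (d 0) + Finsupp.single 1 (d 1) := by
    ext k; fin_cases k <;> simp
  rw [mo_eq, ← hu, C_mul_monomial, mul_one]

/-- weight two polynomials come from the ideal -/
theorem weight_two {p : ℕ} {ε : ℂ} (hε : IsPrimitiveRoot ε (2 * p + 3)) {σ : MvPolynomial (Fin 2) ℂ →ₐ[ℂ] MvPolynomial (Fin 2) ℂ}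
    (hσx : σ (X 0) = C ε * X 0) (hσy : σ (X 1) = C (ε ^ 2) * X 1)
    {R : Type} [CommRing R] [Algebra ℂ R] (j : R →ₐ[ℂ] MvPolynomial (Fin 2) ℂ)
    (hr : ∀ f, σ f = f → ∃ r, j r = f) (a b₁ : R) (ha : j a = X 0 ^ (2 * p + 3))
    (hb : j b₁ = X 0 ^ (2 * p + 1) * X 1) (I : Ideal R) (hI : I = Ideal.span {a, b₁})
    (f : MvPolynomial (Fin 2) ℂ) (hf : σ f = C (ε ^ 2) * f) : ∃ i : I, j i = X 0 ^ (2 * p + 1) * f := by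
  have haI : a ∈ I := hI ▸ Ideal.subset_span (by simp)
  have hbI : b₁ ∈ I := hI ▸ Ideal.subset_span (by simp)
  have key : ∀ s : Finset (Fin 2 →₀ ℕ), (∀ d ∈ s, coeff d f ≠ 0) →
      ∃ i : I, j i = X 0 ^ (2 * p + 1) * ∑ d ∈ s, monomial d (coeff d f) := by
    intro s
    induction s using Finset.induction_on with
    | empty => intro _; exact ⟨0, by simp⟩
    | insert d s hd ih =>
      intro hs
      obtain ⟨i, hi⟩ := ih fun d hd => hs d (Finset.mem_insert_of_mem hd)
      have h0 := hs d (Finset.mem_insert_self _ _)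
      have h1 : ε ^ (d 0 + 2 * d 1) = ε ^ 2 := by
        have := congrArg (coeff d) hf
        rw [sigma_coeff hσx hσy, coeff_C_mul] at this
        exact mul_right_cancel₀ h0 this
      have h2 := (prim_pow_iff (by omega) hε _ _).1 h1
      rw [Finset.sum_insert hd, mul_add, ← hi, monomial_eq_mo]
      suffices ∃ i : I, j i = X 0 ^ (2 * p + 1) * (C (coeff d f) * mo (d 0) (d 1)) by
        obtain ⟨i', hi'⟩ := this
        exact ⟨i' + i, by rw [← hi']; simp⟩
      rcases Nat.eq_zero_or_pos (d 1) with h | h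
      · have h3 : 2 ≤ d 0 := by
          rw [h] at h2
          by_contra hc
          have h4 : d 0 < 2 * p + 3 := by omega
          rw [Nat.ModEq, Nat.mod_eq_of_lt (by omega), Nat.mod_eq_of_lt (by omega)] at h2
          omega
        obtain ⟨q, hq⟩ := Nat.exists_eq_add_of_le h3
        have h5 : ε ^ (q + 2 * 0) = 1 := by
          have := (prim_pow_iff (by omega) hε (q + 2 * 0) 0).2
          rw [this, pow_zero]
          rw [h, hq] at h2
          refine Nat.ModEq.add_left_cancel' 2 ?_
          simpa [add_comm, add_assoc] using h2
        obtain ⟨r, hr⟩ := hr (C (coeff d f) * mo q 0) (by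
          rw [sigma_monomial hσx hσy, h5]; simp)
        refine ⟨⟨r * a, I.mul_mem_left _ haI⟩, ?_⟩
        simp only [map_mul, hr, ha, h, hq, mo]; ring
      · obtain ⟨q, hq⟩ := Nat.exists_eq_add_of_le h
        have h5 : ε ^ (d 0 + 2 * q) = 1 := by
          have := (prim_pow_iff (by omega) hε (d 0 + 2 * q) 0).2
          rw [this, pow_zero]
          rw [hq] at h2
          refine Nat.ModEq.add_left_cancel' 2 ?_
          convert h2 using 1; omega
        obtain ⟨r, hr⟩ := hr (C (coeff d f) * mo (d 0) q) (by
          rw [sigma_monomial hσx hσy, h5]; simp)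
        refine ⟨⟨r * b₁, I.mul_mem_left _ hbI⟩, ?_⟩
        simp only [map_mul, hr, hb, hq, mo]; ring
  have := key f.support fun d hd => mem_support_iff.1 hd
  rwa [← f.as_sum] at this

theorem X_dvd_lem {α β : MvPolynomial (Fin 2) ℂ} (h : X 1 * α = X 0 ^ 2 * β) :
    ∃ s, α = X 0 ^ 2 * s ∧ β = X 1 * s := by
  have hp : Prime (X 0 : MvPolynomial (Fin 2) ℂ) := X_prime
  have hnd : ¬ (X 0 : MvPolynomial (Fin 2) ℂ) ∣ X 1 := by
    rw [X_dvd_X]; simp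
  have hd : (X 0 : MvPolynomial (Fin 2) ℂ) ^ 2 ∣ α := by
    have : (X 0 : MvPolynomial (Fin 2) ℂ) ^ 2 ∣ X 1 * α := ⟨β, h⟩
    exact hp.pow_dvd_of_dvd_mul_left 2 hnd this
  obtain ⟨s, rfl⟩ := hd
  refine ⟨s, rfl, ?_⟩
  have h2 : (X 0 : MvPolynomial (Fin 2) ℂ) ^ 2 ≠ 0 := pow_ne_zero _ (X_ne_zero 0)
  apply mul_left_cancel₀ h2
  rw [← h]; ring

/-- abstract version -/
theorem TT_equiv_End {p : ℕ} {ε : ℂ} (hε : IsPrimitiveRoot ε (2 * p + 3)) {σ : MvPolynomial (Fin 2) ℂ →ₐ[ℂ] MvPolynomial (Fin 2) ℂ}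
    (hσx : σ (X 0) = C ε * X 0) (hσy : σ (X 1) = C (ε ^ 2) * X 1)
    {R : Type} [CommRing R] [Algebra ℂ R] (j : R →ₐ[ℂ] MvPolynomial (Fin 2) ℂ) (hj : Function.Injective j)
    (hfix : ∀ r, σ (j r) = j r)
    (hr : ∀ f, σ f = f → ∃ r, j r = f) (a b₁ : R) (ha : j a = X 0 ^ (2 * p + 3))
    (hb : j b₁ = X 0 ^ (2 * p + 1) * X 1) (I : Ideal R) (hI : I = Ideal.span {a, b₁}) :
    Nonempty (TT ε σ ≃ₐ[ℂ] (Module.End R (R × I))ᵐᵒᵖ) := by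
  have haI : a ∈ I := hI ▸ Ideal.subset_span (by simp)
  have hbI : b₁ ∈ I := hI ▸ Ideal.subset_span (by simp)
  have hε0 : ε ≠ 0 := hε.ne_zero (by omega)
  have hx0 : (X 0 : MvPolynomial (Fin 2) ℂ) ≠ 0 := X_ne_zero 0
  have hxk : (X 0 : MvPolynomial (Fin 2) ℂ) ^ (2 * p + 1) ≠ 0 := pow_ne_zero _ hx0
  have hx2 : (X 0 : MvPolynomial (Fin 2) ℂ) ^ 2 ≠ 0 := pow_ne_zero _ hx0
  -- the division map
  have hμ : ∀ i : I, ∃ q : MvPolynomial (Fin 2) ℂ, X 0 ^ (2 * p + 1) * q = j i := by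
    rintro ⟨i, hi⟩
    rw [hI, Ideal.mem_span_pair] at hi
    obtain ⟨u, v, rfl⟩ := hi
    refine ⟨j u * X 0 ^ 2 + j v * X 1, ?_⟩
    simp only [map_add, map_mul, ha, hb]; ring
  choose μ hμ using hμ
  let κ : R × I → Fin 2 → MvPolynomial (Fin 2) ℂ := fun v => ![j v.1, μ v.2]
  have κ0 : ∀ v, κ v 0 = j v.1 := fun v => rfl
  have κ1 : ∀ v, X 0 ^ (2 * p + 1) * κ v 1 = j v.2 := fun v => hμ v.2
  have κext : ∀ v (w : Fin 2 → MvPolynomial (Fin 2) ℂ), j v.1 = w 0 → j v.2 = X 0 ^ (2 * p + 1) * w 1 → κ v = w := by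
    intro v w h0 h1
    funext i
    fin_cases i
    · exact h0
    · apply mul_left_cancel₀ hxk
      exact (κ1 v).trans h1
  have κadd : ∀ v w, κ (v + w) = κ v + κ w := by
    intro v w
    apply κext
    · simp [κ0]
    · simp only [Pi.add_apply, mul_add, κ1]; simp
  have κsmul : ∀ (r : R) v, κ (r • v) = j r • κ v := by
    intro r v
    apply κext
    · simp [κ0]
    · rw [Pi.smul_apply, smul_eq_mul, mul_left_comm, κ1]; simp
  have κcsmul : ∀ (r : ℂ) v, κ (r • v) = r • κ v := by
    intro r v
    apply κext
    · simp [κ0]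
    · simp only [Pi.smul_apply, mul_smul_comm, κ1]; simp
  have κinj : Function.Injective κ := by
    intro v w h
    have h0 : v.1 = w.1 := hj (by rw [← κ0, ← κ0, h])
    have h1 : (v.2 : R) = w.2 := hj (by rw [← κ1, ← κ1, h])
    exact Prod.ext h0 (Subtype.ext h1)
  have κmem : ∀ v (i : Fin 2), σ (κ v i) = C (ε ^ (2 * (i : ℕ))) * κ v i := by
    intro v i
    fin_cases i
    · show σ (κ v 0) = C (ε ^ (2 * 0)) * κ v 0
      rw [κ0, hfix]; simp
    · show σ (κ v 1) = C (ε ^ (2 * 1)) * κ v 1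
      have h : σ (X 0 ^ (2 * p + 1) * κ v 1) = X 0 ^ (2 * p + 1) * κ v 1 := by
        rw [κ1, hfix]
      rw [map_mul, map_pow, hσx, mul_pow] at h
      apply mul_left_cancel₀ hxk
      have h3 : C (ε ^ 2) * (C ε : MvPolynomial (Fin 2) ℂ) ^ (2 * p + 1) = 1 := by
        rw [← C_pow, ← C_mul, ← pow_add, show 2 + (2 * p + 1) = 2 * p + 3 by ring,
          hε.pow_eq_one, C_1]
      linear_combination C (ε ^ 2) * h - X 0 ^ (2 * p + 1) * σ (κ v 1) * h3
  have κsurj : ∀ w : Fin 2 → MvPolynomial (Fin 2) ℂ, (∀ i : Fin 2, σ (w i) = C (ε ^ (2 * (i : ℕ))) * w i) →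
      ∃ v, κ v = w := by
    intro w hw
    obtain ⟨r, h0⟩ := hr (w 0) (by simpa using hw 0)
    obtain ⟨i, h1⟩ := weight_two hε hσx hσy j hr a b₁ ha hb I hI (w 1) (by simpa using hw 1)
    exact ⟨(r, i), κext _ _ h0 h1⟩
  have hL : ∀ (M : TT ε σ) (v : R × I), ∃ w, κ w = Matrix.vecMul (κ v) M.1 := by
    intro M v
    apply κsurj
    intro i
    simp only [Matrix.vecMul, dotProduct, map_sum, map_mul, Finset.mul_sum]
    refine Finset.sum_congr rfl fun k _ => ?_
    have := M.2 k i
    rw [κmem, mul_right_comm, mul_comm _ (σ _), mul_comm (σ _), this]; ring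
  choose L hL using hL
  let Lin : TT ε σ → Module.End R (R × I) := fun M =>
    { toFun := L M
      map_add' := fun v w => κinj (by
        rw [κadd, hL, hL, hL, κadd, Matrix.add_vecMul])
      map_smul' := fun r v => κinj (by
        rw [RingHom.id_apply, κsmul, hL, hL, κsmul, Matrix.smul_vecMul]) }
  have hLin : ∀ M v, κ (Lin M v) = Matrix.vecMul (κ v) M.1 := hL
  let Φ : TT ε σ →ₐ[ℂ] (Module.End R (R × I))ᵐᵒᵖ :=
    { toFun := fun M => MulOpposite.op (Lin M)
      map_one' := by
        apply MulOpposite.unop_injective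
        refine LinearMap.ext fun v => κinj ?_
        show κ (Lin 1 v) = κ v
        rw [hLin]
        exact Matrix.vecMul_one _
      map_mul' := by
        intro M N
        apply MulOpposite.unop_injective
        refine LinearMap.ext fun v => κinj ?_
        show κ (Lin (M * N) v) = κ (Lin N (Lin M v))
        rw [hLin, hLin, hLin, Matrix.vecMul_vecMul]; rfl
      map_zero' := by
        apply MulOpposite.unop_injective
        refine LinearMap.ext fun v => κinj ?_
        show κ (Lin 0 v) = κ 0
        rw [hLin]
        have h0 : κ 0 = 0 := by simpa using κcsmul 0 0
        rw [h0]
        exact Matrix.vecMul_zero _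
      map_add' := by
        intro M N
        apply MulOpposite.unop_injective
        refine LinearMap.ext fun v => κinj ?_
        show κ (Lin (M + N) v) = κ (Lin M v + Lin N v)
        rw [κadd, hLin, hLin, hLin]
        exact Matrix.vecMul_add _ _ _
      commutes' := by
        intro c
        apply MulOpposite.unop_injective
        refine LinearMap.ext fun v => κinj ?_
        show κ (Lin (algebraMap ℂ _ c) v) = κ (c • v)
        rw [hLin, κcsmul]
        have : ((algebraMap ℂ (TT ε σ) c : TT ε σ) : Mat2) = c • 1 := by
          rw [Subalgebra.coe_algebraMap, Algebra.algebraMap_eq_smul_one]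
        rw [this, Matrix.vecMul_smul, Matrix.vecMul_one] }
  have κ10 : κ (1, 0) = ![1, 0] := κext _ _ (by simp) (by simp)
  have κ0a : κ (0, ⟨a, haI⟩) = ![0, X 0 ^ 2] := κext _ _ (by simp) (by simp [ha]; ring)
  have κ0b : κ (0, ⟨b₁, hbI⟩) = ![0, X 1] := κext _ _ (by simp) (by simp [hb])
  refine ⟨AlgEquiv.ofBijective Φ ⟨?_, ?_⟩⟩
  · rw [injective_iff_map_eq_zero]
    intro M hM
    have h : ∀ v, Matrix.vecMul (κ v) M.1 = 0 := by
      intro v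
      rw [← hLin]
      have h1 : Lin M = 0 := MulOpposite.op_injective hM
      rw [h1]
      simpa using κcsmul 0 0
    apply Subtype.ext
    ext1 i k
    fin_cases i
    · have := congrFun (h (1, 0)) k
      rw [κ10] at this
      simpa [Matrix.vecMul, dotProduct] using this
    · have := congrFun (h (0, ⟨a, haI⟩)) k
      rw [κ0a] at this
      simpa [Matrix.vecMul, dotProduct] using this
  · intro F
    obtain ⟨f, rfl⟩ := MulOpposite.op_surjective F
    have hs : ∀ k : Fin 2, ∃ s, κ (f (0, ⟨a, haI⟩)) k = X 0 ^ 2 * s ∧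
        κ (f (0, ⟨b₁, hbI⟩)) k = X 1 * s := by
      intro k
      apply X_dvd_lem
      have h1 : b₁ • ((0, ⟨a, haI⟩) : R × I) = a • ((0, ⟨b₁, hbI⟩) : R × I) := by
        refine Prod.ext (by simp) (Subtype.ext ?_)
        simp [mul_comm]
      have h2 := congrArg (fun v => κ (f v) k) h1
      simp only [map_smul, κsmul, Pi.smul_apply, smul_eq_mul, ha, hb] at h2
      apply mul_left_cancel₀ hxk
      rw [← mul_assoc, h2]; ring
    choose s hsa hsb using hs
    let M : Mat2 := ![κ (f (1, 0)), s]
    have hM : M ∈ TT ε σ := by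
      intro i k
      fin_cases i
      · show C (ε ^ (2 * 0)) * σ (κ (f (1, 0)) k) = _ * κ (f (1, 0)) k
        rw [κmem]; simp
      · show C (ε ^ (2 * 1)) * σ (s k) = _ * s k
        have h := κmem (f (0, ⟨a, haI⟩)) k
        rw [hsa, map_mul, map_pow, hσx] at h
        apply mul_left_cancel₀ hx2
        rw [mul_one, C_pow]
        linear_combination h
    refine ⟨⟨M, hM⟩, ?_⟩
    apply MulOpposite.unop_injective
    show Lin ⟨M, hM⟩ = f
    have e1 : Lin ⟨M, hM⟩ (1, 0) = f (1, 0) := by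
      apply κinj
      rw [hLin, κ10]
      funext k
      simp [Matrix.vecMul, dotProduct, M]
    have e2 : Lin ⟨M, hM⟩ (0, ⟨a, haI⟩) = f (0, ⟨a, haI⟩) := by
      apply κinj
      rw [hLin, κ0a]
      funext k
      rw [hsa]
      simp [Matrix.vecMul, dotProduct, M]
    have e3 : Lin ⟨M, hM⟩ (0, ⟨b₁, hbI⟩) = f (0, ⟨b₁, hbI⟩) := by
      apply κinj
      rw [hLin, κ0b]
      funext k
      rw [hsb]
      simp [Matrix.vecMul, dotProduct, M]
    refine LinearMap.ext ?_
    rintro ⟨r, i, hi⟩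
    have hi' := hi
    rw [hI, Ideal.mem_span_pair] at hi'
    obtain ⟨u, w, huw⟩ := hi'
    have hdec : ((r, ⟨i, hi⟩) : R × I) =
        r • ((1, 0) : R × I) + u • ((0, ⟨a, haI⟩) : R × I) + w • ((0, ⟨b₁, hbI⟩) : R × I) := by
      refine Prod.ext (by simp) (Subtype.ext ?_)
      simp [huw]
    rw [hdec, map_add, map_add, map_smul, map_smul, map_smul, e1, e2, e3, map_add, map_add,
      map_smul, map_smul, map_smul]



/-- Let `R = ℂ[x, y]^G` be the invariant ring of `G = 1/m(1,2)`
(`m = 2n − 1`, `n ≥ 3`), let `a = x^m`, `b₁ = x^{m−2} y ∈ R` and `I = (a, b₁) ⊆ R`.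
Then `Λ_n ≅ End_R(R ⊕ I)` as ℂ-algebras, where endomorphisms are composed left to
right (so `End_R(R ⊕ I)` with this convention is the opposite of `Module.End`). -/
theorem lambda_iso_end_of_invariant_ring
    (n : ℕ) (hn : 3 ≤ n) (m : ℕ) (hm : m = 2 * n - 1)
    (ε : ℂ) (hε : IsPrimitiveRoot ε m)
    (σ : MvPolynomial (Fin 2) ℂ →ₐ[ℂ] MvPolynomial (Fin 2) ℂ)
    (hσx : σ (X 0) = C ε * X 0)
    (hσy : σ (X 1) = C (ε ^ 2) * X 1)
    -- `R` is (identified via `e` with) the invariant ring `ℂ[x,y]^G`,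
    -- the fixed subalgebra of `σ`:
    (R : Type) [CommRing R] [Algebra ℂ R]
    (e : R ≃ₐ[ℂ] (AlgHom.equalizer σ (AlgHom.id ℂ (MvPolynomial (Fin 2) ℂ))))
    -- `a = x^m` and `b₁ = x^{m-2} y` as elements of `R`:
    (a b₁ : R)
    (ha : ((e a : AlgHom.equalizer σ (AlgHom.id ℂ (MvPolynomial (Fin 2) ℂ))) :
      MvPolynomial (Fin 2) ℂ) = X 0 ^ m)
    (hb : ((e b₁ : AlgHom.equalizer σ (AlgHom.id ℂ (MvPolynomial (Fin 2) ℂ))) :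
      MvPolynomial (Fin 2) ℂ) = X 0 ^ (m - 2) * X 1)
    -- `I` is the ideal of `R` generated by `a` and `b₁`:
    (I : Ideal R) (hI : I = Ideal.span {a, b₁}) :
    Nonempty ((Lambda n) ≃ₐ[ℂ] (Module.End R (R × I))ᵐᵒᵖ) := by
  obtain ⟨p, rfl⟩ : ∃ p, n = p + 2 := ⟨n - 2, by omega⟩
  obtain rfl : m = 2 * p + 3 := by omega
  let j : R →ₐ[ℂ] MvPolynomial (Fin 2) ℂ :=
    (Subalgebra.val (AlgHom.equalizer σ (AlgHom.id ℂ (MvPolynomial (Fin 2) ℂ)))).comp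
      (e : R →ₐ[ℂ] (AlgHom.equalizer σ (AlgHom.id ℂ (MvPolynomial (Fin 2) ℂ))))
  have hj : ∀ r, j r = ((e r : AlgHom.equalizer σ (AlgHom.id ℂ (MvPolynomial (Fin 2) ℂ))) :
      MvPolynomial (Fin 2) ℂ) := fun r => rfl
  obtain ⟨E1⟩ := lambda_equiv_TT (by omega : 1 ≤ p) hε hσx hσy
  obtain ⟨E2⟩ := TT_equiv_End hε hσx hσy j
    (fun r s h => e.injective (Subtype.ext h)) (fun r => (e r).2)
    (fun f hf => ⟨e.symm ⟨f, hf⟩, by rw [hj, AlgEquiv.apply_symm_apply]⟩)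
    a b₁ ha hb I hI
  exact ⟨E1.trans E2⟩
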